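/- arXiv:2201.06184 — 2 statements merged into one kernel-verified Lean document; each statement's English description precedes it below -/
import Mathlib

section
/- Unconditionally, for every real x > 2, ∫_2^x (Π(t) − li(t))/t² dt < 0. -/
open MeasureTheory Filter

/-- `PiR x = ∑_{p^m ≤ x} 1/m`, the Riemann prime-counting function
(sum over prime powers `p^m ≤ x` with `m ≥ 1`). -/
noncomputable def PiR (x : ℝ) : ℝ :=
  ∑ n ∈ Finset.Icc 1 ⌊x⌋₊,
    if IsPrimePow n then (1 : ℝ) / (n.factorization n.minFac) else 0

/-- `li x` is the logarithmic integral, defined for `x > 1` as the Cauchy principal value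
`lim_{ε→0⁺} (∫_0^{1-ε} du/log u + ∫_{1+ε}^x du/log u)`. -/
noncomputable def li (x : ℝ) : ℝ :=
  limUnder (nhdsWithin (0:ℝ) (Set.Ioi 0)) (fun ε =>
    (∫ u in (0:ℝ)..(1 - ε), 1 / Real.log u) + ∫ u in (1 + ε)..x, 1 / Real.log u)


section LiPart
open Real Set

noncomputable def gg (s : ℝ) : ℝ := 1 / log (1 + s) + 1 / log (1 - s)

lemma eta_nonneg {s : ℝ} (h0 : 0 ≤ s) (h1 : s < 1) :
    0 ≤ 2 * s + (1 - s) * log (1 - s) - (1 + s) * log (1 + s) := by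
  have hd : ∀ x ∈ Ico (0:ℝ) 1, HasDerivAt (fun s => 2 * s + (1 - s) * log (1 - s) - (1 + s) * log (1 + s))
      (- log (1 - x) - log (1 + x)) x := by
    intro x hx
    have e1 : HasDerivAt (fun s : ℝ => 1 - s) (-1) x := by
      simpa using (hasDerivAt_id x).const_sub 1
    have e2 : HasDerivAt (fun s : ℝ => 1 + s) 1 x := by
      simpa using (hasDerivAt_id x).const_add 1
    have n1 : (1 - x) ≠ 0 := by linarith [hx.2]
    have n2 : (1 + x) ≠ 0 := by linarith [hx.1]
    have := (((hasDerivAt_id x).const_mul 2).add (e1.mul (e1.log n1))).sub (e2.mul (e2.log n2))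
    refine this.congr_deriv ?_
    field_simp
    ring
  have hm : MonotoneOn (fun s => 2 * s + (1 - s) * log (1 - s) - (1 + s) * log (1 + s)) (Ico (0:ℝ) 1) := by
    apply monotoneOn_of_deriv_nonneg (convex_Ico 0 1)
    · intro x hx
      exact (hd x hx).continuousAt.continuousWithinAt
    · intro x hx
      rw [interior_Ico] at hx
      exact (hd x ⟨hx.1.le, hx.2⟩).differentiableAt.differentiableWithinAt
    · intro x hx
      rw [interior_Ico] at hx
      rw [(hd x ⟨hx.1.le, hx.2⟩).deriv]
      have : log (1 - x) + log (1 + x) ≤ 0 := by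
        rw [← log_mul (by linarith [hx.2]) (by linarith [hx.1])]
        apply log_nonpos <;> nlinarith [hx.1, hx.2]
      linarith
  have := hm (⟨le_refl _, one_pos⟩ : (0:ℝ) ∈ Ico (0:ℝ) 1) ⟨h0, h1⟩ h0
  simpa using this

lemma phi_nonneg {s : ℝ} (h0 : 0 ≤ s) (h1 : s < 1) :
    0 ≤ - log (1 - s) - log (1 + s) + log (1 + s) * log (1 - s) := by
  have hd : ∀ x ∈ Ico (0:ℝ) 1, HasDerivAt (fun s => - log (1 - s) - log (1 + s) + log (1 + s) * log (1 - s))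
      ((2 * x + (1 - x) * log (1 - x) - (1 + x) * log (1 + x)) / ((1 - x) * (1 + x))) x := by
    intro x hx
    have e1 : HasDerivAt (fun s : ℝ => 1 - s) (-1) x := by
      simpa using (hasDerivAt_id x).const_sub 1
    have e2 : HasDerivAt (fun s : ℝ => 1 + s) 1 x := by
      simpa using (hasDerivAt_id x).const_add 1
    have n1 : (1 - x) ≠ 0 := by linarith [hx.2]
    have n2 : (1 + x) ≠ 0 := by linarith [hx.1]
    have := ((e1.log n1).neg.sub (e2.log n2)).add ((e2.log n2).mul (e1.log n1))
    refine this.congr_deriv ?_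
    field_simp
    ring
  have hm : MonotoneOn (fun s => - log (1 - s) - log (1 + s) + log (1 + s) * log (1 - s)) (Ico (0:ℝ) 1) := by
    apply monotoneOn_of_deriv_nonneg (convex_Ico 0 1)
    · intro x hx
      exact (hd x hx).continuousAt.continuousWithinAt
    · intro x hx
      rw [interior_Ico] at hx
      exact (hd x ⟨hx.1.le, hx.2⟩).differentiableAt.differentiableWithinAt
    · intro x hx
      rw [interior_Ico] at hx
      rw [(hd x ⟨hx.1.le, hx.2⟩).deriv]
      apply div_nonneg (eta_nonneg hx.1.le hx.2)
      apply mul_nonneg <;> linarith [hx.1, hx.2]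
  have := hm (⟨le_refl _, one_pos⟩ : (0:ℝ) ∈ Ico (0:ℝ) 1) ⟨h0, h1⟩ h0
  simpa using this

lemma gg_ge {s : ℝ} (h0 : 0 < s) (h1 : s < 1) : 1 ≤ gg s := by
  have ha : 0 < log (1 + s) := log_pos (by linarith)
  have hb : log (1 - s) < 0 := log_neg (by linarith) (by linarith)
  have := phi_nonneg h0.le h1
  have hn : log (1 + s) * log (1 - s) < 0 := mul_neg_of_pos_of_neg ha hb
  unfold gg
  rw [div_add_div _ _ ha.ne' hb.ne, le_div_iff_of_neg hn]
  linarith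

lemma gg_le {s : ℝ} (h0 : 0 < s) (h1 : s < 1) : gg s ≤ 2 := by
  have ha : s / (1 + s) ≤ log (1 + s) := by
    have := one_sub_inv_le_log_of_pos (show 0 < 1 + s by linarith)
    have e : s / (1 + s) = 1 - (1 + s)⁻¹ := by field_simp; ring
    linarith
  have hb : - (s / (1 - s)) ≤ log (1 - s) := by
    have := one_sub_inv_le_log_of_pos (show 0 < 1 - s by linarith)
    have h : 1 - s ≠ 0 := by linarith
    have e : -(s / (1 - s)) = 1 - (1 - s)⁻¹ := by field_simp; ring
    linarith
  have hb0 : log (1 - s) < 0 := log_neg (by linarith) (by linarith)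
  have h2 : 0 < 1 - s := by linarith
  have a1 : 1 / log (1 + s) ≤ (1 + s) / s := by
    rw [← one_div_div s (1 + s)]
    exact one_div_le_one_div_of_le (by positivity) ha
  have a2 : 1 / log (1 - s) ≤ - ((1 - s) / s) := by
    have : 1 / (s / (1 - s)) ≤ 1 / (- log (1 - s)) :=
      one_div_le_one_div_of_le (by linarith) (by linarith)
    rw [one_div_div, one_div_neg_eq_neg_one_div] at this
    linarith
  unfold gg
  have : (1 + s) / s - (1 - s) / s = 2 := by field_simp; ring
  linarith

lemma meas_gg : Measurable gg := by
  unfold gg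
  fun_prop

lemma gg_ii : IntervalIntegrable gg volume 0 1 := by
  rw [intervalIntegrable_iff_integrableOn_Ioo_of_le zero_le_one]
  refine Measure.integrableOn_of_bounded (M := 2) (by simp) meas_gg.aestronglyMeasurable ?_
  rw [ae_restrict_iff' measurableSet_Ioo]
  filter_upwards with s hs
  rw [Real.norm_eq_abs, abs_le]
  constructor <;> linarith [gg_ge hs.1 hs.2, gg_le hs.1 hs.2]

lemma intlog_left {e : ℝ} (h0 : 0 < e) (h1 : e < 1) :
    IntervalIntegrable (fun s => 1 / log (1 - s)) volume e 1 := by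
  rw [intervalIntegrable_iff_integrableOn_Ioo_of_le h1.le]
  refine Measure.integrableOn_of_bounded (M := 1 / e) (by simp) (Measurable.aestronglyMeasurable (by fun_prop)) ?_
  rw [ae_restrict_iff' measurableSet_Ioo]
  filter_upwards with s hs
  have := log_le_sub_one_of_pos (show 0 < 1 - s by linarith [hs.2])
  rw [Real.norm_eq_abs, abs_div, abs_one, abs_of_neg (by linarith [hs.1])]
  exact one_div_le_one_div_of_le h0 (by linarith [hs.1])

lemma intlog_right {a b : ℝ} (ha : 1 < a) (hb : 1 < b) :
    IntervalIntegrable (fun s => 1 / log s) volume a b := by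
  apply ContinuousOn.intervalIntegrable
  intro x hx
  have : 1 < x := lt_of_lt_of_le (lt_min ha hb) hx.1
  have h2 := log_pos this
  apply ContinuousAt.continuousWithinAt
  have := continuousAt_log (show x ≠ 0 by linarith)
  exact continuousAt_const.div this h2.ne'

lemma li_eq {x : ℝ} (hx : 2 ≤ x) :
    li x = (∫ s in (0:ℝ)..1, gg s) + ∫ u in (2:ℝ)..x, 1 / log u := by
  unfold li
  apply Filter.Tendsto.limUnder_eq
  have hc : Tendsto (fun e : ℝ => (∫ s in e..1, gg s) + ∫ u in (2:ℝ)..x, 1 / log u)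
      (nhdsWithin (0:ℝ) (Set.Ioi 0)) (nhds ((∫ s in (0:ℝ)..1, gg s) + ∫ u in (2:ℝ)..x, 1 / log u)) := by
    apply Tendsto.add_const
    have hcont : ContinuousOn (fun e : ℝ => ∫ s in (1:ℝ)..e, gg s) (uIcc 0 1) := by
      apply intervalIntegral.continuousOn_primitive_interval'
      · exact gg_ii
      · simp
    have h2 : Tendsto (fun e : ℝ => ∫ s in (1:ℝ)..e, gg s) (nhdsWithin (0:ℝ) (Set.Ioi 0))
        (nhds (∫ s in (1:ℝ)..0, gg s)) := by
      have := (hcont 0 (by simp)).tendsto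
      rw [uIcc_of_le zero_le_one] at this
      refine this.mono_left ?_
      rw [nhdsWithin_le_iff]
      exact Icc_mem_nhdsGT one_pos
    have h3 := h2.neg
    simp_rw [← intervalIntegral.integral_symm] at h3
    exact h3
  refine hc.congr' ?_
  have : Ioo (0:ℝ) 1 ∈ nhdsWithin (0:ℝ) (Set.Ioi 0) := Ioo_mem_nhdsGT one_pos
  filter_upwards [this] with e he
  have e1 : ∫ u in (0:ℝ)..(1 - e), 1 / log u = ∫ s in e..1, 1 / log (1 - s) := by
    rw [intervalIntegral.integral_comp_sub_left (fun u => 1 / log u) 1]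
    simp
  have e2 : ∫ u in (1 + e)..2, 1 / log u = ∫ s in e..1, 1 / log (1 + s) := by
    rw [intervalIntegral.integral_comp_add_left (fun u => 1 / log u) 1]
    norm_num
  have i3 : IntervalIntegrable (fun s => 1 / log (1 + s)) volume e 1 := by
    have := (intlog_right (show 1 < 1 + e by linarith [he.1]) (show (1:ℝ) < 2 by norm_num)).comp_add_left 1
    simpa [show (2:ℝ) - 1 = 1 by norm_num] using this
  have e3 : ∫ u in (1 + e)..x, 1 / log u = (∫ u in (1 + e)..2, 1 / log u) + ∫ u in (2:ℝ)..x, 1 / log u := by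
    rw [intervalIntegral.integral_add_adjacent_intervals]
    · exact intlog_right (by linarith [he.1]) (by norm_num)
    · exact intlog_right (by norm_num) (by linarith)
  rw [e3, e1, e2, ← add_assoc]
  congr 1
  rw [add_comm, ← intervalIntegral.integral_add i3 (intlog_left he.1 he.2)]
  rfl

lemma gg_int_ge : 1 ≤ ∫ s in (0:ℝ)..1, gg s := by
  have : ∫ s in (0:ℝ)..1, (1:ℝ) ≤ ∫ s in (0:ℝ)..1, gg s := by
    apply intervalIntegral.integral_mono_on_of_le_Ioo zero_le_one (by simp) gg_ii
    intro s hs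
    exact gg_ge hs.1 hs.2
  simpa using this

end LiPart

section QPart
open Real Set
open ArithmeticFunction (vonMangoldt vonMangoldt_apply vonMangoldt_nonneg vonMangoldt_sum vonMangoldt_apply_one vonMangoldt_apply_prime)
open scoped ArithmeticFunction.vonMangoldt

noncomputable def Sf (t : ℝ) : ℝ := ∑ n ∈ Finset.Icc 3 ⌊t⌋₊, Λ n * (1 / n - 1 / t)

noncomputable def Qf (t : ℝ) : ℝ := Sf t - (log t - log 2 - 1 + 2 / t)

def allB (f : ℕ → Bool) (n : ℕ) : Bool := Nat.rec true (fun k ih => f k && ih) n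

lemma allB_spec {f : ℕ → Bool} {n : ℕ} (h : allB f n = true) : ∀ k < n, f k = true := by
  induction n with
  | zero => intro k hk; omega
  | succ n ih =>
    have h' : (f n && allB f n) = true := h
    rw [Bool.and_eq_true] at h'
    intro k hk
    rcases Nat.lt_succ_iff_lt_or_eq.1 hk with hk | rfl
    · exact ih h'.2 k hk
    · exact h'.1

/-- Table of `1024 * log_2 n` rounded down, for `n < 128`. -/
def lowT : List ℕ :=
  [0, 0, 1024, 1623, 2048, 2377, 2647, 2874, 3072, 3246, 3401, 3542, 3671, 3789, 3898, 4000,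
   4096, 4185, 4270, 4349, 4425, 4497, 4566, 4632, 4695, 4755, 4813, 4869, 4922, 4974, 5024, 5073,
   5120, 5165, 5209, 5252, 5294, 5334, 5373, 5412, 5449, 5486, 5521, 5556, 5590, 5623, 5656, 5687,
   5719, 5749, 5779, 5808, 5837, 5865, 5893, 5920, 5946, 5972, 5998, 6023, 6048, 6073, 6097, 6120,
   6144, 6166, 6189, 6211, 6233, 6255, 6276, 6297, 6318, 6338, 6358, 6378, 6397, 6417, 6436, 6455,
   6473, 6492, 6510, 6528, 6545, 6563, 6580, 6597, 6614, 6631, 6647, 6663, 6680, 6696, 6711, 6727,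
   6743, 6758, 6773, 6788, 6803, 6818, 6832, 6846, 6861, 6875, 6889, 6903, 6917, 6930, 6944, 6957,
   6970, 6983, 6996, 7009, 7022, 7035, 7047, 7060, 7072, 7084, 7097, 7109, 7121, 7132, 7144, 7156]

def lowL (n : ℕ) : ℕ := lowT.getD n 0

def lowOk (n : ℕ) : Bool :=
  Nat.ble (Nat.pow 2 (lowL n)) (Nat.pow n 1024) && Nat.ble (Nat.pow n 1024) (Nat.pow 2 (lowL n + 1))

lemma lowT_ok : allB (fun k => lowOk (Nat.succ k)) 127 = true := by decide +kernel

lemma ble_pow {a b c d : ℕ} (h : Nat.ble (Nat.pow a b) (Nat.pow c d) = true) : a ^ b ≤ c ^ d :=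
  Nat.le_of_ble_eq_true h

lemma lowOk_spec {n : ℕ} (h : lowOk n = true) :
    2 ^ lowL n ≤ n ^ 1024 ∧ n ^ 1024 ≤ 2 ^ (lowL n + 1) :=
  have h' := (Bool.and_eq_true _ _).mp h
  ⟨ble_pow h'.1, ble_pow h'.2⟩

lemma lowL_ok {n : ℕ} (hn : 0 < n) (hn' : n < 128) :
    2 ^ lowL n ≤ n ^ 1024 ∧ n ^ 1024 ≤ 2 ^ (lowL n + 1) := by
  obtain ⟨k, rfl⟩ : ∃ k, n = k + 1 := ⟨n - 1, by omega⟩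
  exact lowOk_spec (allB_spec lowT_ok k (by omega))

lemma lowL_le {n : ℕ} (hn : 0 < n) (hn' : n < 128) : (lowL n : ℝ) / 1024 * log 2 ≤ log n := by
  have h : 2 ^ lowL n ≤ n ^ 1024 := (lowL_ok hn hn').1
  have h2 : ((2:ℝ) ^ lowL n) ≤ (n:ℝ) ^ 1024 := by exact_mod_cast h
  have := log_le_log (by positivity) h2
  rw [log_pow, log_pow] at this
  push_cast at this
  linarith

lemma le_lowL {n : ℕ} (hn : 0 < n) (hn' : n < 128) : log n ≤ ((lowL n : ℝ) + 1) / 1024 * log 2 := by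
  have h : n ^ 1024 ≤ 2 ^ (lowL n + 1) := (lowL_ok hn hn').2
  have h2 : (n:ℝ) ^ 1024 ≤ ((2:ℝ) ^ (lowL n + 1)) := by exact_mod_cast h
  have := log_le_log (by positivity) h2
  rw [log_pow, log_pow] at this
  push_cast at this
  linarith

/-- Least prime factor, for small arguments. -/
def mf (n : ℕ) : ℕ :=
  bif Nat.beq (n % 2) 0 then 2 else bif Nat.beq (n % 3) 0 then 3 else
  bif Nat.beq (n % 5) 0 then 5 else bif Nat.beq (n % 7) 0 then 7 else n

/-- `102400000` times an upper bound for `Λ n`. -/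
def lamU (n : ℕ) : ℕ :=
  bif Nat.beq (mf n ^ 6 % n) 0 then (lowL (mf n) + 1) * 69315 else 0

lemma mf_eq {n : ℕ} (h3 : 3 ≤ n) (h : n < 64) : n.minFac = mf n := by
  interval_cases n <;> norm_num <;> rfl

lemma lam_le {n : ℕ} (h3 : 3 ≤ n) (h : n < 64) : Λ n ≤ (lamU n : ℝ) / 102400000 := by
  have hl : log 2 ≤ 69315 / 100000 := by linarith [log_two_lt_d9]
  have hmf : 0 < mf n := by rw [← mf_eq h3 h]; exact Nat.minFac_pos n
  have hmf' : mf n < 128 := by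
    rw [← mf_eq h3 h]
    exact lt_of_le_of_lt (Nat.minFac_le (by omega)) (by omega)
  rw [vonMangoldt_apply]
  split_ifs with hp
  · have hd : n ∣ mf n ^ 6 := by
      rw [← mf_eq h3 h]
      have e := hp.minFac_pow_factorization_eq
      conv_lhs => rw [← e]
      apply pow_dvd_pow
      by_contra hlt
      push Not at hlt
      have h2 : 2 ≤ n.minFac := (Nat.minFac_prime (by omega)).two_le
      have : 2 ^ 6 ≤ n := by
        calc 2 ^ 6 ≤ n.minFac ^ 6 := Nat.pow_le_pow_left h2 6
          _ ≤ n.minFac ^ (n.factorization n.minFac) := Nat.pow_le_pow_right (by omega) hlt.le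
          _ = n := e
      omega
    have : mf n ^ 6 % n = 0 := Nat.mod_eq_zero_of_dvd hd
    unfold lamU
    rw [this, mf_eq h3 h]
    refine (le_lowL hmf hmf').trans ?_
    have h0 : (0:ℝ) ≤ lowL (mf n) := by positivity
    have e : Nat.beq 0 0 = true := rfl
    rw [e, cond_true]
    push_cast
    nlinarith
  · positivity

/-- `-102400000` times the bounds. -/
def qq (n : ℕ) : ℕ := bif Nat.blt n 4 then 5632000 else bif Nat.blt n 8 then 9216000 else
  bif Nat.blt n 16 then 16384000 else 19456000

def chk1 (A B l q N M : ℕ) : Bool :=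
  Nat.ble (2 * M * (141957120 + A + q) + (2 * N + 1) * 102400000)
    (2 * M * (l * 69314) + 409600000 + 2 * B)

def chk (A B N : ℕ) : Bool :=
  chk1 A B (lowL (2 * N + 1)) (qq N) N N && chk1 A B (lowL (2 * N + 1)) (qq N) N (N + 1)

def sA (k : ℕ) : ℕ := Nat.rec 0 (fun k s => s + (lamU (k + 3) / (k + 3) + 1)) k

def sB (k : ℕ) : ℕ := Nat.rec 0 (fun k s => s + lamU (k + 3)) k

lemma sA_succ (k : ℕ) : sA (k + 1) = sA k + (lamU (k + 3) / (k + 3) + 1) := rfl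

lemma sB_succ (k : ℕ) : sB (k + 1) = sB k + lamU (k + 3) := rfl

lemma chk_all : allB (fun k => chk (sA (k + 1)) (sB (k + 1)) (k + 3)) 61 = true := by
  decide +kernel

lemma sum_lamU (k : ℕ) (t : ℝ) :
    ∑ n ∈ Finset.Icc 3 (k + 2), (lamU n : ℝ) / 102400000 * (1 / n - 1 / t)
    ≤ (sA k : ℝ) / 102400000 - (sB k : ℝ) / 102400000 / t := by
  induction k with
  | zero => simp [sA, sB]
  | succ k ih =>
    rw [show k + 1 + 2 = (k + 2) + 1 by ring, Finset.sum_Icc_succ_top (by omega), sA_succ, sB_succ]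
    have h1 : lamU (k + 3) < (k + 3) * (lamU (k + 3) / (k + 3) + 1) :=
      Nat.lt_mul_div_succ _ (by omega)
    have h2 : (lamU (k + 3) : ℝ) / ((k + 3 : ℕ) : ℝ) ≤ ((lamU (k + 3) / (k + 3) + 1 : ℕ) : ℝ) := by
      rw [div_le_iff₀ (by positivity), mul_comm]
      exact_mod_cast h1.le
    rw [show k + 2 + 1 = k + 3 by ring, Nat.cast_add (sA k), Nat.cast_add (sB k)]
    generalize ((lamU (k + 3) / (k + 3) + 1 : ℕ) : ℝ) = u at *
    have e : (lamU (k + 3) : ℝ) / 102400000 * (1 / ((k + 3 : ℕ) : ℝ) - 1 / t)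
      = (lamU (k + 3) : ℝ) / ((k + 3 : ℕ) : ℝ) / 102400000
        - (lamU (k + 3) : ℝ) / 102400000 / t := by ring
    rw [e, add_div, add_div, add_div]
    linarith

lemma chk1_real {A B l q N M : ℕ} (hM : 0 < M) (h : chk1 A B l q N M = true) :
    69315 / 100000 + (A : ℝ) / 102400000 - ((l:ℝ) / 1024 * (69314/100000) - 69315/100000)
      + ((2 * (N:ℝ) + 1) / 2 - 2 - (B : ℝ) / 102400000) / M ≤ -(q : ℝ) / 102400000 := by
  have h1 := Nat.le_of_ble_eq_true h
  have h2 : 2 * (M:ℝ) * (141957120 + A + q) + (2 * N + 1) * 102400000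
    ≤ 2 * M * (l * 69314) + 409600000 + 2 * B := by exact_mod_cast h1
  have hM' : (0:ℝ) < M := by exact_mod_cast hM
  rw [← le_sub_iff_add_le', div_le_iff₀ hM']
  linarith

lemma Qf_small {N : ℕ} (h3 : 3 ≤ N) (h : N < 64) {t : ℝ} (ht : (N:ℝ) ≤ t) (ht2 : t < N + 1) :
    Qf t ≤ -(qq N : ℝ) / 102400000 := by
  obtain ⟨k, rfl⟩ : ∃ k, N = k + 3 := ⟨N - 3, by omega⟩
  have hN0 : (0:ℝ) < ((k + 3 : ℕ) : ℝ) := by positivity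
  have ht0 : 0 < t := by linarith
  have hfl : ⌊t⌋₊ = k + 3 := by
    rw [Nat.floor_eq_iff ht0.le]
    exact ⟨ht, ht2⟩
  have hS : Sf t ≤ (sA (k + 1) : ℝ) / 102400000 - (sB (k + 1) : ℝ) / 102400000 / t := by
    refine le_trans ?_ (sum_lamU _ _)
    rw [Sf, hfl]
    apply Finset.sum_le_sum
    intro n hn
    rw [Finset.mem_Icc] at hn
    apply mul_le_mul_of_nonneg_right (lam_le hn.1 (by omega))
    have : (n:ℝ) ≤ t := le_trans (by exact_mod_cast hn.2) ht
    have hn0 : (0:ℝ) < n := by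
      have : 0 < n := by omega
      exact_mod_cast this
    have := one_div_le_one_div_of_le hn0 this
    linarith
  have hchk := allB_spec chk_all k (by omega)
  unfold chk at hchk
  rw [Bool.and_eq_true] at hchk
  obtain ⟨c1, c2⟩ := hchk
  have c1' := chk1_real (by omega) c1
  have c2' := chk1_real (by omega) c2
  have hlow := lowL_le (show 0 < 2 * (k + 3) + 1 by omega) (by omega)
  generalize lowL (2 * (k + 3) + 1) = l at *
  push_cast at c1' c2' hlow
  generalize (sA (k + 1) : ℝ) / 102400000 = A at *
  generalize (sB (k + 1) : ℝ) / 102400000 = B at *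
  generalize -(qq (k + 3) : ℝ) / 102400000 = q at *
  have hk : (0:ℝ) ≤ k := by positivity
  push_cast at ht ht2 hN0
  generalize (k:ℝ) = κ at *
  have hl1 := log_two_gt_d9
  have hl2 := log_two_lt_d9
  have hl0 : (0:ℝ) ≤ l := by positivity
  have hlow' : (l:ℝ) / 1024 * (69314/100000) ≤ log (2 * (κ + 3) + 1) := by
    refine le_trans ?_ hlow
    gcongr
    linarith
  have hlogc : log ((2 * (κ + 3) + 1) / 2) = log (2 * (κ + 3) + 1) - log 2 :=
    log_div (by positivity) (by norm_num)
  have hcp : 0 < (2 * (κ + 3) + 1) / 2 := by positivity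
  set c := (2 * (κ + 3) + 1) / 2 with hc
  have htan : log c + 1 - c / t ≤ log t := by
    have := log_le_sub_one_of_pos (show 0 < c / t by positivity)
    rw [log_div hcp.ne' ht0.ne'] at this
    linarith
  set K := 69315 / 100000 + A - ((l:ℝ) / 1024 * (69314/100000) - 69315/100000) with hK
  have hQ : Qf t ≤ K + (c - 2 - B) / t := by
    unfold Qf
    have : (c - 2 - B) / t = c / t - 2 / t - B / t := by ring
    rw [this]
    linarith
  refine hQ.trans ?_
  have : (c - 2 - B) / t ≤ q - K := by
    have d1 : (c - 2 - B) / (κ + 3) ≤ q - K := by linarith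
    have d2 : (c - 2 - B) / (κ + 3 + 1) ≤ q - K := by linarith
    rw [div_le_iff₀ (by positivity)] at d1 d2 ⊢
    by_cases hq : 0 ≤ q - K
    · nlinarith
    · nlinarith
  linarith

lemma Qf_two {t : ℝ} (h2 : 2 ≤ t) (h3 : t < 3) : Qf t = - (log t - log 2 - 1 + 2 / t) := by
  have hfl : ⌊t⌋₊ = 2 := by
    rw [Nat.floor_eq_iff (by linarith)]
    norm_num
    exact ⟨h2, by linarith⟩
  simp [Qf, Sf, hfl]

lemma Qf_two_nonpos {t : ℝ} (h2 : 2 ≤ t) (h3 : t < 3) : Qf t ≤ 0 := by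
  rw [Qf_two h2 h3]
  have := log_le_sub_one_of_pos (show 0 < 2 / t by positivity)
  rw [log_div (by norm_num) (by linarith)] at this
  linarith

lemma Qf_two_neg {t : ℝ} (h2 : 2 < t) (h3 : t < 3) : Qf t < 0 := by
  rw [Qf_two h2.le h3]
  have := log_lt_sub_one_of_pos (show 0 < 2 / t by positivity) (by
    intro h
    rw [div_eq_one_iff_eq (by linarith)] at h
    linarith)
  rw [log_div (by norm_num) (by linarith)] at this
  linarith

lemma sum_lam_div (N : ℕ) : ∀ M ≥ N, ∑ d ∈ Finset.Icc 1 M, Λ d * ((N / d : ℕ) : ℝ) = log (N.factorial) := by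
  induction N with
  | zero => simp
  | succ N ih =>
    intro M hM
    rw [Nat.factorial_succ, Nat.cast_mul, log_mul (by positivity) (by positivity),
      ← ih M (by omega), ← vonMangoldt_sum]
    have : (N + 1).divisors = (Finset.Icc 1 M).filter (fun d => d ∣ N + 1) := by
      ext d
      simp only [Nat.mem_divisors, Finset.mem_filter, Finset.mem_Icc]
      constructor
      · rintro ⟨h, -⟩
        have := Nat.le_of_dvd (by omega) h
        have := Nat.pos_of_dvd_of_pos h (by omega)
        exact ⟨⟨by omega, by omega⟩, h⟩
      · rintro ⟨-, h⟩
        exact ⟨h, by omega⟩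
    rw [this, Finset.sum_filter, ← Finset.sum_add_distrib]
    apply Finset.sum_congr rfl
    intro d hd
    rw [Nat.succ_div]
    split_ifs <;> push_cast <;> ring

lemma log_fact_le {N : ℕ} (hN : 64 ≤ N) : log (N.factorial) ≤ N * log N - 19/20 * N := by
  induction N, hN using Nat.le_induction with
  | base =>
    have h : Nat.factorial 64 ≤ 2 ^ 296 := by decide +kernel
    have h2 : ((Nat.factorial 64 : ℕ) : ℝ) ≤ (2:ℝ) ^ 296 := by exact_mod_cast h
    have := log_le_log (by positivity) h2
    rw [log_pow] at this
    have e : log ((64 : ℕ) : ℝ) = 6 * log 2 := by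
      rw [show ((64 : ℕ) : ℝ) = 2 ^ 6 by norm_num, log_pow]
      norm_num
    rw [e]
    clear h h2 e
    generalize log ((Nat.factorial 64 : ℕ) : ℝ) = y at *
    push_cast at this ⊢
    linarith [log_two_gt_d9]
  | succ n hn ih =>
    have hn' : (64:ℝ) ≤ n := by exact_mod_cast hn
    rw [Nat.factorial_succ, Nat.cast_mul, log_mul (by positivity) (by positivity)]
    have := one_sub_inv_le_log_of_pos (show 0 < ((n:ℝ) + 1) / n by positivity)
    rw [log_div (by positivity) (by positivity), inv_div] at this
    have h3 := mul_le_mul_of_nonneg_left this (show (0:ℝ) ≤ n by linarith)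
    have h4 : (n:ℝ) * (1 - n / (n + 1)) = 1 - 1 / (n + 1) := by field_simp; ring
    have h5 : 1 / ((n:ℝ) + 1) ≤ 1 / 20 := one_div_le_one_div_of_le (by norm_num) (by linarith)
    push_cast
    nlinarith

lemma Qf_large {t : ℝ} (ht : 64 ≤ t) : Qf t ≤ 397 / 1000 := by
  have ht0 : 0 < t := by linarith
  set N := ⌊t⌋₊ with hN
  have hN64 : 64 ≤ N := Nat.le_floor (by exact_mod_cast ht)
  have hN64' : (64:ℝ) ≤ N := by exact_mod_cast hN64
  have hNt : (N:ℝ) ≤ t := Nat.floor_le ht0.le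
  have h1 : ∑ d ∈ Finset.Icc 1 N, Λ d * (1 / d - 1 / t) ≤ log (N.factorial) / t := by
    rw [← sum_lam_div N N le_rfl, Finset.sum_div]
    apply Finset.sum_le_sum
    intro d hd
    rw [Finset.mem_Icc] at hd
    rw [mul_div_assoc]
    apply mul_le_mul_of_nonneg_left _ vonMangoldt_nonneg
    rw [hN, ← Nat.floor_div_natCast, le_div_iff₀ ht0]
    have hd0 : (0:ℝ) < d := by exact_mod_cast hd.1
    have := Nat.lt_floor_add_one (t / d)
    have e : (1 / (d:ℝ) - 1 / t) * t = t / d - 1 := by field_simp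
    rw [e]; linarith
  have h2 : ∑ d ∈ Finset.Icc 1 N, Λ d * (1 / d - 1 / t) = log 2 * (1 / 2 - 1 / t) + Sf t := by
    have : Finset.Icc 1 N = insert 1 (insert 2 (Finset.Icc 3 N)) := by
      ext d; simp only [Finset.mem_insert, Finset.mem_Icc]; omega
    rw [this, Finset.sum_insert (by simp), Finset.sum_insert (by simp), vonMangoldt_apply_one,
      vonMangoldt_apply_prime Nat.prime_two, Sf, ← hN]
    push_cast
    ring
  have h3 : log (N.factorial) / t ≤ log t - 19/20 := by
    rw [div_le_iff₀ ht0]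
    refine (log_fact_le hN64).trans ?_
    have hl : log N ≤ log t := log_le_log (by linarith) hNt
    have hl2 : log 64 ≤ log N := log_le_log (by norm_num) hN64'
    have e : log (64:ℝ) = 6 * log 2 := by
      rw [show (64 : ℝ) = 2 ^ 6 by norm_num, log_pow]
      norm_num
    have := log_two_gt_d9
    nlinarith
  unfold Qf
  have h4 : (0:ℝ) < 1 / t := by positivity
  have h5 : 2 / t = 2 * (1 / t) := by ring
  have := log_two_lt_d9
  rw [h5]
  nlinarith

end QPart

section IntPart
open Real Set
open ArithmeticFunction (vonMangoldt vonMangoldt_apply vonMangoldt_nonneg vonMangoldt_sum vonMangoldt_apply_one vonMangoldt_apply_prime)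
open scoped ArithmeticFunction.vonMangoldt

noncomputable def rr (x t : ℝ) : ℝ := (1 / t - 1 / x) / log t
noncomputable def ww (x t : ℝ) : ℝ := 1 / log t + (1 - t / x) / log t ^ 2
noncomputable def mm (x t : ℝ) : ℝ :=
  1 / (t * log t ^ 2) + 2 * (1 - t / x) / (t * log t ^ 3) + 1 / (x * log t ^ 2)

lemma hasDerivAt_ww {x t : ℝ} (hx : 0 < x) (ht : 1 < t) : HasDerivAt (ww x) (-(mm x t)) t := by
  have hl := log_pos ht
  have ht0 : t ≠ 0 := by linarith
  have h1 := hasDerivAt_log ht0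
  have h2 : HasDerivAt (fun t : ℝ => 1 - t / x) (-(1 / x)) t := by
    simpa using ((hasDerivAt_id t).div_const x).const_sub 1
  have h3 : HasDerivAt (fun t : ℝ => log t ^ 2) (2 * log t * t⁻¹) t := by
    exact (h1.pow 2).congr_deriv (by simp)
  have := ((hasDerivAt_const t (1:ℝ)).div h1 hl.ne').add (h2.div h3 (pow_ne_zero 2 hl.ne'))
  refine this.congr_deriv ?_
  simp only [mm]
  field_simp
  ring

lemma hasDerivAt_rr {x t : ℝ} (hx : 0 < x) (ht : 1 < t) :
    HasDerivAt (rr x) (-(ww x t / t ^ 2)) t := by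
  have hl := log_pos ht
  have ht0 : t ≠ 0 := by linarith
  have h1 := hasDerivAt_log ht0
  have h2 : HasDerivAt (fun t : ℝ => 1 / t - 1 / x) (-(1 / t ^ 2)) t := by
    have := (hasDerivAt_inv ht0).sub_const (1 / x)
    simpa [one_div] using this
  have := h2.div h1 hl.ne'
  refine this.congr_deriv ?_
  simp only [ww]
  field_simp
  ring

lemma mm_nonneg {x t : ℝ} (ht : 1 < t) (hx : t ≤ x) : 0 ≤ mm x t := by
  have hl := log_pos ht
  have hx0 : 0 < x := by linarith
  have : 0 ≤ 1 - t / x := by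
    rw [sub_nonneg, div_le_one hx0]; exact hx
  unfold mm
  positivity

lemma mm_cont {x : ℝ} (hx : 0 < x) : ContinuousOn (mm x) (Ioi 1) := by
  intro t ht
  have hl := log_pos ht
  have ht0 : t ≠ 0 := by linarith [mem_Ioi.1 ht]
  have h1 := continuousAt_log ht0
  have hn : t * log t ^ 2 ≠ 0 := by positivity
  have hn3 : t * log t ^ 3 ≠ 0 := by positivity
  have hn2 : x * log t ^ 2 ≠ 0 := by positivity
  apply ContinuousAt.continuousWithinAt
  unfold mm
  fun_prop (disch := assumption)

lemma cont_of_deriv {f f' : ℝ → ℝ} (h : ∀ t, 1 < t → HasDerivAt f (f' t) t) :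
    ContinuousOn f (Ioi 1) := fun t ht => (h t ht).continuousAt.continuousWithinAt

lemma ww_cont {x : ℝ} (hx : 0 < x) : ContinuousOn (ww x) (Ioi 1) :=
  fun _ ht => (hasDerivAt_ww hx ht).continuousAt.continuousWithinAt

lemma rr_cont {x : ℝ} (hx : 0 < x) : ContinuousOn (rr x) (Ioi 1) :=
  fun _ ht => (hasDerivAt_rr hx ht).continuousAt.continuousWithinAt

lemma uIcc_sub {a b : ℝ} (ha : 1 < a) (hb : 1 < b) : uIcc a b ⊆ Ioi 1 :=
  fun _ ht => lt_of_lt_of_le (lt_min ha hb) ht.1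

lemma ii_of_cont {f : ℝ → ℝ} (hf : ContinuousOn f (Ioi 1)) {a b : ℝ} (ha : 1 < a) (hb : 1 < b) :
    IntervalIntegrable f volume a b := (hf.mono (uIcc_sub ha hb)).intervalIntegrable

lemma inv_cont : ContinuousOn (fun t : ℝ => 1 / t) (Ioi 1) := by
  intro t ht
  have ht0 : t ≠ 0 := by linarith [mem_Ioi.1 ht]
  exact ContinuousAt.continuousWithinAt (continuousAt_const.div continuousAt_id ht0)

lemma log_cont : ContinuousOn (fun t : ℝ => log t) (Ioi 1) := by
  intro t ht
  have ht0 : t ≠ 0 := by linarith [mem_Ioi.1 ht]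
  exact (continuousAt_log ht0).continuousWithinAt

lemma invlog_cont : ContinuousOn (fun t : ℝ => 1 / log t) (Ioi 1) :=
  continuousOn_const.div log_cont (fun _ ht => (log_pos ht).ne')

lemma invsq_cont : ContinuousOn (fun t : ℝ => 1 / t ^ 2) (Ioi 1) := by
  intro t ht
  have ht0 : t ≠ 0 := by linarith [mem_Ioi.1 ht]
  exact ContinuousAt.continuousWithinAt (continuousAt_const.div (continuousAt_id.pow 2) (pow_ne_zero 2 ht0))

lemma int_mm {x a b : ℝ} (hx : 0 < x) (ha : 1 < a) (hb : 1 < b) :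
    ∫ t in a..b, mm x t = ww x a - ww x b := by
  have := intervalIntegral.integral_eq_sub_of_hasDerivAt (f := fun t => - ww x t) (f' := mm x)
    (a := a) (b := b) (fun t ht => by
      have := (hasDerivAt_ww hx (uIcc_sub ha hb ht)).neg
      exact this.congr_deriv (neg_neg _)) (ii_of_cont (mm_cont hx) ha hb)
  rw [this]; ring

lemma ww_self {x : ℝ} (hx : 0 < x) : ww x x = 1 / log x := by
  unfold ww; rw [div_self hx.ne']; simp

lemma int_I1 {x n : ℝ} (hx : 1 < x) (hn : 1 < n) :
    ∫ t in n..x, (1 / n - 1 / t) * mm x t = rr x n - (1 / n - 1 / x) / log x := by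
  have hx0 : 0 < x := by linarith
  have := intervalIntegral.integral_eq_sub_of_hasDerivAt
    (f := fun t => - (ww x t * (1 / n - 1 / t)) - rr x t) (f' := fun t => (1 / n - 1 / t) * mm x t)
    (a := n) (b := x) (fun t ht => by
      have ht1 : 1 < t := uIcc_sub hn hx ht
      have ht0 : t ≠ 0 := by linarith
      have h2 : HasDerivAt (fun t : ℝ => 1 / n - 1 / t) (1 / t ^ 2) t := by
        have := (hasDerivAt_inv ht0).const_sub (1 / n)
        simpa [one_div] using this
      have := ((hasDerivAt_ww hx0 ht1).mul h2).neg.sub (hasDerivAt_rr hx0 ht1)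
      refine this.congr_deriv ?_
      ring) (ii_of_cont ((continuousOn_const.sub inv_cont).mul (mm_cont hx0)) hn hx)
  rw [this, ww_self hx0]
  simp only [rr, sub_self]
  ring

noncomputable def K1 (t : ℝ) : ℝ := log t - log 2 - 1 + 2 / t

lemma K1_cont : ContinuousOn K1 (Ioi 1) := by
  have : K1 = fun t => log t - log 2 - 1 + 2 * (1 / t) := by
    ext t; unfold K1; ring
  rw [this]
  exact ((log_cont.sub continuousOn_const).sub continuousOn_const).add (continuousOn_const.mul inv_cont)

lemma int_I2 {x : ℝ} (hx : 1 < x) :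
    ∫ t in (2:ℝ)..x, rr x t = K1 x / log x + ∫ t in (2:ℝ)..x, K1 t * mm x t := by
  have hx0 : 0 < x := by linarith
  have h12 : (1:ℝ) < 2 := by norm_num
  have i1 : IntervalIntegrable (fun t => rr x t) volume 2 x := ii_of_cont (rr_cont hx0) h12 hx
  have i2 : IntervalIntegrable (fun t => K1 t * mm x t) volume 2 x :=
    ii_of_cont (K1_cont.mul (mm_cont hx0)) h12 hx
  have := intervalIntegral.integral_eq_sub_of_hasDerivAt
    (f := fun t => ww x t * K1 t + (t - 2) * rr x t) (f' := fun t => rr x t - K1 t * mm x t)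
    (a := 2) (b := x) (fun t ht => by
      have ht1 : 1 < t := uIcc_sub h12 hx ht
      have ht0 : t ≠ 0 := by linarith
      have h2 : HasDerivAt K1 (1 / t - 2 / t ^ 2) t := by
        have := (((hasDerivAt_log ht0).sub_const (log 2)).sub_const 1).add
          ((hasDerivAt_inv ht0).const_mul 2)
        refine this.congr_deriv ?_
        field_simp
        ring
      have h3 : HasDerivAt (fun t : ℝ => t - 2) 1 t := (hasDerivAt_id t).sub_const 2
      have := ((hasDerivAt_ww hx0 ht1).mul h2).add (h3.mul (hasDerivAt_rr hx0 ht1))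
      refine this.congr_deriv ?_
      field_simp
      ring) (i1.sub i2)
  rw [intervalIntegral.integral_sub i1 i2, ww_self hx0] at this
  have e1 : rr x x = 0 := by simp [rr]
  have e2 : K1 2 = 0 := by unfold K1; norm_num
  rw [e1, e2] at this
  have e3 : K1 x / log x = 1 / log x * K1 x := by ring
  rw [e3]
  linarith

noncomputable def LL (t : ℝ) : ℝ := ∫ u in (2:ℝ)..t, 1 / log u

lemma hasDerivAt_LL {t : ℝ} (ht : 1 < t) : HasDerivAt LL (1 / log t) t := by
  have h12 : (1:ℝ) < 2 := by norm_num
  apply intervalIntegral.integral_hasDerivAt_right (ii_of_cont invlog_cont h12 ht)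
  · exact invlog_cont.stronglyMeasurableAtFilter isOpen_Ioi t ht
  · exact invlog_cont.continuousAt (isOpen_Ioi.mem_nhds ht)

lemma LL_cont : ContinuousOn LL (Ioi 1) :=
  fun _ ht => (hasDerivAt_LL ht).continuousAt.continuousWithinAt

lemma int_I3 {x : ℝ} (hx : 1 < x) :
    ∫ t in (2:ℝ)..x, LL t / t ^ 2 = ∫ t in (2:ℝ)..x, rr x t := by
  have hx0 : 0 < x := by linarith
  have h12 : (1:ℝ) < 2 := by norm_num
  have i1 : IntervalIntegrable (fun t => rr x t) volume 2 x := ii_of_cont (rr_cont hx0) h12 hx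
  have i2 : IntervalIntegrable (fun t => LL t / t ^ 2) volume 2 x := by
    have : IntervalIntegrable (fun t => LL t * (1 / t ^ 2)) volume 2 x :=
      ii_of_cont (LL_cont.mul invsq_cont) h12 hx
    simpa [div_eq_mul_inv] using this
  have := intervalIntegral.integral_eq_sub_of_hasDerivAt
    (f := fun t => LL t * (1 / t - 1 / x)) (f' := fun t => rr x t - LL t / t ^ 2)
    (a := 2) (b := x) (fun t ht => by
      have ht1 : 1 < t := uIcc_sub h12 hx ht
      have ht0 : t ≠ 0 := by linarith
      have h2 : HasDerivAt (fun t : ℝ => 1 / t - 1 / x) (-(1 / t ^ 2)) t := by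
        have := (hasDerivAt_inv ht0).sub_const (1 / x)
        simpa [one_div] using this
      have := (hasDerivAt_LL ht1).mul h2
      refine this.congr_deriv ?_
      unfold rr
      ring) (i1.sub i2)
  rw [intervalIntegral.integral_sub i1 i2] at this
  have e : LL 2 = 0 := by simp [LL]
  rw [e] at this
  simp at this
  linarith

lemma ind_int {f : ℝ → ℝ} (hf : ContinuousOn f (Ioi 1)) {n x : ℝ} (hn : 2 < n) (hx : n ≤ x) :
    IntervalIntegrable (fun t => if n ≤ t then f t else 0) volume 2 x ∧
    ∫ t in (2:ℝ)..x, (if n ≤ t then f t else 0) = ∫ t in n..x, f t := by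
  have h12 : (1:ℝ) < 2 := by norm_num
  have hx2 : 2 ≤ x := by linarith
  have e : (fun t => if n ≤ t then f t else 0) = indicator (Ici n) f := by
    ext t; simp [indicator, mem_Ici]
  have i := ii_of_cont hf h12 (show 1 < x by linarith)
  rw [e]
  constructor
  · rw [intervalIntegrable_iff_integrableOn_Ioc_of_le hx2] at i ⊢
    exact i.indicator measurableSet_Ici
  · rw [intervalIntegral.integral_of_le hx2, intervalIntegral.integral_of_le hx,
      setIntegral_indicator measurableSet_Ici, ← integral_Icc_eq_integral_Ioc]
    congr 2
    ext t
    simp only [mem_inter_iff, mem_Ioc, mem_Ici, mem_Icc]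
    constructor
    · rintro ⟨⟨_, h⟩, h2⟩; exact ⟨h2, h⟩
    · rintro ⟨h, h2⟩; exact ⟨⟨by linarith, h2⟩, h⟩

lemma PiR_term {n : ℕ} (hn : 2 ≤ n) :
    (if IsPrimePow n then (1 : ℝ) / (n.factorization n.minFac) else 0) = Λ n / log n := by
  rw [vonMangoldt_apply]
  split_ifs with h
  · have e := h.minFac_pow_factorization_eq
    have hp := (Nat.minFac_prime (show n ≠ 1 by omega)).one_lt
    have hl : 0 < log (n.minFac : ℝ) := log_pos (by exact_mod_cast hp)
    have hk : n.factorization n.minFac ≠ 0 := by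
      intro h0; rw [h0] at e; simp at e; omega
    have e2 : log (n:ℝ) = (n.factorization n.minFac : ℝ) * log (n.minFac : ℝ) := by
      conv_lhs => rw [← e]
      rw [Nat.cast_pow, log_pow]
    rw [e2]
    have hk' : (n.factorization n.minFac : ℝ) ≠ 0 := by exact_mod_cast hk
    field_simp
  · simp

lemma sum_floor (g : ℕ → ℝ) {x t : ℝ} (ht : 2 ≤ t) (htx : t ≤ x) :
    ∑ n ∈ Finset.Icc 3 ⌊t⌋₊, g n = ∑ n ∈ Finset.Icc 3 ⌊x⌋₊, if (n:ℝ) ≤ t then g n else 0 := by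
  rw [← Finset.sum_filter]
  congr 1
  ext n
  have hfl : ⌊t⌋₊ ≤ ⌊x⌋₊ := Nat.floor_le_floor htx
  simp only [Finset.mem_Icc, Finset.mem_filter]
  rw [← Nat.le_floor_iff (by linarith : (0:ℝ) ≤ t)]
  omega

lemma PiR_eq {x t : ℝ} (ht : 2 ≤ t) (htx : t ≤ x) :
    PiR t = 1 + ∑ n ∈ Finset.Icc 3 ⌊x⌋₊, if (n:ℝ) ≤ t then Λ n / log n else 0 := by
  rw [← sum_floor (fun n => Λ n / log n) ht htx]
  unfold PiR
  have h2 : 2 ≤ ⌊t⌋₊ := Nat.le_floor (by exact_mod_cast ht)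
  have : Finset.Icc 1 ⌊t⌋₊ = insert 1 (insert 2 (Finset.Icc 3 ⌊t⌋₊)) := by
    ext d; simp only [Finset.mem_insert, Finset.mem_Icc]; omega
  rw [this, Finset.sum_insert (by simp), Finset.sum_insert (by simp), PiR_term le_rfl,
    vonMangoldt_apply_prime Nat.prime_two]
  have hl : log ((2:ℕ):ℝ) ≠ 0 := by
    have := log_pos (show (1:ℝ) < 2 by norm_num)
    simpa using this.ne'
  rw [div_self hl, if_neg not_isPrimePow_one, zero_add]
  congr 1
  apply Finset.sum_congr rfl
  intro n hn
  rw [Finset.mem_Icc] at hn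
  exact PiR_term (by omega)

lemma n_facts {x : ℝ} (hx : 2 < x) {n : ℕ} (hn : n ∈ Finset.Icc 3 ⌊x⌋₊) :
    2 < (n:ℝ) ∧ (n:ℝ) ≤ x := by
  rw [Finset.mem_Icc] at hn
  constructor
  · have : 2 < n := by omega
    exact_mod_cast this
  · exact (Nat.le_floor_iff (by linarith)).1 hn.2

lemma int_PiR {x : ℝ} (hx : 2 < x) :
    IntervalIntegrable (fun t => PiR t / t ^ 2) volume 2 x ∧
    ∫ t in (2:ℝ)..x, PiR t / t ^ 2 = (1 / 2 - 1 / x) + ∑ n ∈ Finset.Icc 3 ⌊x⌋₊, Λ n * rr x n := by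
  have h12 : (1:ℝ) < 2 := by norm_num
  have hx1 : 1 < x := by linarith
  have hsq : ∀ a, 1 < a → ∫ t in a..x, 1 / t ^ 2 = 1 / a - 1 / x := by
    intro a ha
    have := intervalIntegral.integral_eq_sub_of_hasDerivAt
      (f := fun t : ℝ => - t⁻¹) (f' := fun t => 1 / t ^ 2) (a := a) (b := x) (fun t ht => by
      have ht1 : 1 < t := uIcc_sub ha hx1 ht
      have := (hasDerivAt_inv (show t ≠ 0 by linarith)).neg
      exact this.congr_deriv (by simp)) (ii_of_cont invsq_cont ha hx1)
    rw [this]; simp only [one_div]; ring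
  have hc : ∀ n : ℕ, ContinuousOn (fun t : ℝ => Λ n / log n * (1 / t ^ 2)) (Ioi 1) :=
    fun n => continuousOn_const.mul invsq_cont
  have hi := fun n (hn : n ∈ Finset.Icc 3 ⌊x⌋₊) =>
    ind_int (hc n) (n_facts hx hn).1 (n_facts hx hn).2
  have i0 : IntervalIntegrable (fun t : ℝ => 1 / t ^ 2) volume 2 x := ii_of_cont invsq_cont h12 hx1
  have i1 : IntervalIntegrable (fun t : ℝ => ∑ n ∈ Finset.Icc 3 ⌊x⌋₊,
      if (n:ℝ) ≤ t then Λ n / log n * (1 / t ^ 2) else 0) volume 2 x := by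
    have := IntervalIntegrable.sum (Finset.Icc 3 ⌊x⌋₊) (fun n hn => (hi n hn).1)
    refine this.congr ?_
    intro t _
    simp
  have e : EqOn (fun t => PiR t / t ^ 2) (fun t : ℝ => 1 / t ^ 2 + ∑ n ∈ Finset.Icc 3 ⌊x⌋₊,
      if (n:ℝ) ≤ t then Λ n / log n * (1 / t ^ 2) else 0) (uIcc 2 x) := by
    intro t ht
    rw [uIcc_of_le hx.le] at ht
    simp only
    rw [PiR_eq ht.1 ht.2, add_div, Finset.sum_div]
    congr 1
    apply Finset.sum_congr rfl
    intro n _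
    split_ifs <;> ring
  constructor
  · refine (i0.add i1).congr ?_
    intro t ht
    exact (e (uIoc_subset_uIcc ht)).symm
  · rw [intervalIntegral.integral_congr e, intervalIntegral.integral_add i0 i1, hsq 2 h12,
      intervalIntegral.integral_finsetSum (fun n hn => (hi n hn).1)]
    congr 1
    apply Finset.sum_congr rfl
    intro n hn
    rw [(hi n hn).2, intervalIntegral.integral_const_mul, hsq n (by linarith [(n_facts hx hn).1])]
    unfold rr
    ring

lemma int_Sf {x : ℝ} (hx : 2 < x) :
    IntervalIntegrable (fun t => Sf t * mm x t) volume 2 x ∧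
    ∑ n ∈ Finset.Icc 3 ⌊x⌋₊, Λ n * rr x n = Sf x / log x + ∫ t in (2:ℝ)..x, Sf t * mm x t := by
  have hx1 : 1 < x := by linarith
  have hx0 : 0 < x := by linarith
  have hc : ∀ n : ℕ, ContinuousOn (fun t : ℝ => Λ n * ((1 / n - 1 / t) * mm x t)) (Ioi 1) :=
    fun n => continuousOn_const.mul ((continuousOn_const.sub inv_cont).mul (mm_cont hx0))
  have hi := fun n (hn : n ∈ Finset.Icc 3 ⌊x⌋₊) =>
    ind_int (hc n) (n_facts hx hn).1 (n_facts hx hn).2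
  have i1 : IntervalIntegrable (fun t : ℝ => ∑ n ∈ Finset.Icc 3 ⌊x⌋₊,
      if (n:ℝ) ≤ t then Λ n * ((1 / n - 1 / t) * mm x t) else 0) volume 2 x := by
    have := IntervalIntegrable.sum (Finset.Icc 3 ⌊x⌋₊) (fun n hn => (hi n hn).1)
    refine this.congr ?_
    intro t _
    simp
  have e : EqOn (fun t => Sf t * mm x t) (fun t : ℝ => ∑ n ∈ Finset.Icc 3 ⌊x⌋₊,
      if (n:ℝ) ≤ t then Λ n * ((1 / n - 1 / t) * mm x t) else 0) (uIcc 2 x) := by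
    intro t ht
    rw [uIcc_of_le hx.le] at ht
    simp only
    rw [Sf, sum_floor (fun n => Λ n * (1 / n - 1 / t)) ht.1 ht.2, Finset.sum_mul]
    apply Finset.sum_congr rfl
    intro n _
    split_ifs <;> ring
  constructor
  · refine i1.congr ?_
    intro t ht
    exact (e (uIoc_subset_uIcc ht)).symm
  · rw [intervalIntegral.integral_congr e,
      intervalIntegral.integral_finsetSum (fun n hn => (hi n hn).1), Sf, Finset.sum_div,
      ← Finset.sum_add_distrib]
    apply Finset.sum_congr rfl
    intro n hn
    rw [(hi n hn).2, intervalIntegral.integral_const_mul, int_I1 hx1 (by linarith [(n_facts hx hn).1])]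
    ring

lemma Qf_eq (t : ℝ) : Qf t = Sf t - K1 t := rfl

lemma Qf_ii {x : ℝ} (hx : 2 < x) : IntervalIntegrable (fun t => Qf t * mm x t) volume 2 x := by
  have hx0 : 0 < x := by linarith
  have i2 : IntervalIntegrable (fun t => K1 t * mm x t) volume 2 x :=
    ii_of_cont (K1_cont.mul (mm_cont hx0)) (by norm_num) (by linarith)
  simp only [Qf_eq, sub_mul]
  exact (int_Sf hx).1.sub i2

lemma main_le {x : ℝ} (hx : 2 < x) :
    (∫ t in (2:ℝ)..x, (PiR t - li t) / t ^ 2) ≤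
      Qf x / log x + ∫ t in (2:ℝ)..x, Qf t * mm x t := by
  have hx1 : 1 < x := by linarith
  have hx0 : 0 < x := by linarith
  have h12 : (1:ℝ) < 2 := by norm_num
  have i2 : IntervalIntegrable (fun t => K1 t * mm x t) volume 2 x :=
    ii_of_cont (K1_cont.mul (mm_cont hx0)) (by norm_num) (by linarith)
  have i3 : IntervalIntegrable (fun t => LL t / t ^ 2) volume 2 x := by
    have : IntervalIntegrable (fun t => LL t * (1 / t ^ 2)) volume 2 x :=
      ii_of_cont (LL_cont.mul invsq_cont) h12 hx1
    simpa [div_eq_mul_inv] using this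
  have i4 : IntervalIntegrable (fun t => PiR t / t ^ 2 - LL t / t ^ 2 - 1 / t ^ 2) volume 2 x :=
    ((int_PiR hx).1.sub i3).sub (ii_of_cont invsq_cont h12 hx1)
  have i0 : IntervalIntegrable (fun t : ℝ => 1 / t ^ 2) volume 2 x := ii_of_cont invsq_cont h12 hx1
  set C := ∫ s in (0:ℝ)..1, gg s with hC
  have i5 : IntervalIntegrable (fun t => (PiR t / t ^ 2 - LL t / t ^ 2) - C * (1 / t ^ 2)) volume 2 x :=
    ((int_PiR hx).1.sub i3).sub (i0.const_mul C)
  have hsq : ∫ t in (2:ℝ)..x, 1 / t ^ 2 = 1 / 2 - 1 / x := by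
    have := intervalIntegral.integral_eq_sub_of_hasDerivAt
      (f := fun t : ℝ => - t⁻¹) (f' := fun t => 1 / t ^ 2) (a := 2) (b := x) (fun t ht => by
      have ht1 : 1 < t := uIcc_sub h12 hx1 ht
      have := (hasDerivAt_inv (show t ≠ 0 by linarith)).neg
      exact this.congr_deriv (by simp)) i0
    rw [this]; simp only [one_div]; ring
  have e : ∫ t in (2:ℝ)..x, (PiR t - li t) / t ^ 2 =
      ∫ t in (2:ℝ)..x, ((PiR t / t ^ 2 - LL t / t ^ 2) - C * (1 / t ^ 2)) := by
    apply intervalIntegral.integral_congr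
    intro t ht
    rw [uIcc_of_le hx.le] at ht
    simp only
    rw [li_eq ht.1, ← hC]
    unfold LL
    ring
  rw [e, intervalIntegral.integral_sub ((int_PiR hx).1.sub i3) (i0.const_mul C),
    intervalIntegral.integral_sub (int_PiR hx).1 i3, intervalIntegral.integral_const_mul, hsq,
    (int_PiR hx).2, (int_Sf hx).2, int_I3 hx1, int_I2 hx1]
  simp only [Qf_eq, sub_mul]
  rw [intervalIntegral.integral_sub (int_Sf hx).1 i2]
  have hC1 : 1 ≤ C := gg_int_ge
  have : 1 / x ≤ 1 / 2 := one_div_le_one_div_of_le (by norm_num) hx.le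
  have h6 : (Sf x - K1 x) / log x = Sf x / log x - K1 x / log x := by ring
  rw [h6]
  nlinarith

lemma step_le {x a b q : ℝ} (hx : 2 < x) (ha : 2 ≤ a) (hab : a ≤ b) (hb : b ≤ x)
    (hq : ∀ t, a ≤ t → t < b → Qf t ≤ q) :
    ∫ t in a..b, Qf t * mm x t ≤ q * (ww x a - ww x b) := by
  rw [← int_mm (by linarith) (by linarith) (by linarith), ← intervalIntegral.integral_const_mul]
  apply intervalIntegral.integral_mono_on_of_le_Ioo hab
  · apply (Qf_ii hx).mono_set
    rw [uIcc_of_le hab, uIcc_of_le hx.le]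
    exact Icc_subset_Icc ha hb
  · exact (ii_of_cont (mm_cont (by linarith)) (by linarith) (by linarith)).const_mul q
  · intro t ht
    exact mul_le_mul_of_nonneg_right (hq t ht.1.le ht.2) (mm_nonneg (by linarith [ht.1]) (by linarith [ht.2]))

lemma Qf_floor {t : ℝ} (h3 : 3 ≤ t) (h : t < 64) : Qf t ≤ -(qq ⌊t⌋₊ : ℝ) / 102400000 := by
  have h0 : 0 ≤ t := by linarith
  apply Qf_small _ _ (Nat.floor_le h0) (Nat.lt_floor_add_one t)
  · exact Nat.le_floor (by exact_mod_cast h3)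
  · exact (Nat.floor_lt h0).2 (by exact_mod_cast h)

lemma blt_pos {a b : ℕ} (h : a < b) : Nat.blt a b = true := Nat.ble_eq_true_of_le h

lemma blt_neg {a b : ℕ} (h : ¬ a < b) : Nat.blt a b = false := by
  rw [← Bool.not_eq_true]
  exact fun h' => h (Nat.le_of_ble_eq_true h')

lemma Qf_3 {t : ℝ} (h3 : 3 ≤ t) (h : t < 4) : Qf t ≤ -55/1000 := by
  have h1 := Qf_floor h3 (by linarith)
  have : ⌊t⌋₊ < 4 := (Nat.floor_lt (by linarith)).2 (by exact_mod_cast h)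
  unfold qq at h1
  rw [blt_pos this, cond_true] at h1
  push_cast at h1
  linarith

lemma Qf_4 {t : ℝ} (h3 : 4 ≤ t) (h : t < 8) : Qf t ≤ -9/100 := by
  have h1 := Qf_floor (by linarith) (by linarith)
  have a : ⌊t⌋₊ < 8 := (Nat.floor_lt (by linarith)).2 (by exact_mod_cast h)
  have b : ¬ ⌊t⌋₊ < 4 := not_lt.2 (Nat.le_floor (by exact_mod_cast h3))
  unfold qq at h1
  rw [blt_neg b, blt_pos a, cond_false, cond_true] at h1
  push_cast at h1
  linarith

lemma Qf_8 {t : ℝ} (h3 : 8 ≤ t) (h : t < 16) : Qf t ≤ -16/100 := by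
  have h1 := Qf_floor (by linarith) (by linarith)
  have a : ⌊t⌋₊ < 16 := (Nat.floor_lt (by linarith)).2 (by exact_mod_cast h)
  have b : ¬ ⌊t⌋₊ < 8 := not_lt.2 (Nat.le_floor (by exact_mod_cast h3))
  unfold qq at h1
  rw [blt_neg (show ¬ ⌊t⌋₊ < 4 by omega), blt_neg b, blt_pos a, cond_false, cond_false,
    cond_true] at h1
  push_cast at h1
  linarith

lemma Qf_16 {t : ℝ} (h3 : 16 ≤ t) (h : t < 64) : Qf t ≤ -19/100 := by
  have h1 := Qf_floor (by linarith) (by linarith)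
  have b : ¬ ⌊t⌋₊ < 16 := not_lt.2 (Nat.le_floor (by exact_mod_cast h3))
  unfold qq at h1
  rw [blt_neg (show ¬ ⌊t⌋₊ < 4 by omega), blt_neg (show ¬ ⌊t⌋₊ < 8 by omega), blt_neg b,
    cond_false, cond_false, cond_false] at h1
  push_cast at h1
  linarith

lemma Qf_neg {t : ℝ} (h2 : 2 < t) (h : t < 64) : Qf t < 0 := by
  rcases lt_or_ge t 3 with h3 | h3
  · exact Qf_two_neg h2 h3
  rcases lt_or_ge t 4 with h4 | h4
  · linarith [Qf_3 h3 h4]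
  rcases lt_or_ge t 8 with h8 | h8
  · linarith [Qf_4 h4 h8]
  rcases lt_or_ge t 16 with h16 | h16
  · linarith [Qf_8 h8 h16]
  · linarith [Qf_16 h16 h]

lemma final_num {x : ℝ} (hx : 64 ≤ x) :
    -55/1000 * (ww x 3 - ww x 4) + -9/100 * (ww x 4 - ww x 8) + -16/100 * (ww x 8 - ww x 16)
      + -19/100 * (ww x 16 - ww x 64) + 397/1000 * ww x 64 < 0 := by
  have l4 : log (4:ℝ) = 2 * log 2 := by
    rw [show (4 : ℝ) = 2 ^ 2 by norm_num, log_pow]; norm_num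
  have l8 : log (8:ℝ) = 3 * log 2 := by
    rw [show (8 : ℝ) = 2 ^ 3 by norm_num, log_pow]; norm_num
  have l16 : log (16:ℝ) = 4 * log 2 := by
    rw [show (16 : ℝ) = 2 ^ 4 by norm_num, log_pow]; norm_num
  have l64 : log (64:ℝ) = 6 * log 2 := by
    rw [show (64 : ℝ) = 2 ^ 6 by norm_num, log_pow]; norm_num
  have h3 : 41 * log (3:ℝ) ≤ 65 * log 2 := by
    have := log_le_log (by norm_num) (show (3:ℝ) ^ 41 ≤ 2 ^ 65 by norm_num)
    rw [log_pow, log_pow] at this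
    exact_mod_cast this
  have h30 : 0 < log (3:ℝ) := log_pos (by norm_num)
  have g1 := log_two_gt_d9
  have g2 := log_two_lt_d9
  have hv0 : 0 < 1 / x := by positivity
  have hv : 1 / x ≤ 1 / 64 := one_div_le_one_div_of_le (by norm_num) hx
  have u1 : 1.4426 ≤ 1 / log 2 := by
    rw [le_div_iff₀ (by linarith)]; linarith
  have u2 : 1 / log 2 ≤ 1.4428 := by
    rw [div_le_iff₀ (by linarith)]; linarith
  have u3 : 41 / 65 * (1 / log 2) ≤ 1 / log 3 := by
    rw [← div_eq_mul_one_div, div_le_div_iff₀ (by linarith) h30]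
    linarith
  have e : ∀ k : ℝ, ∀ t : ℝ, log t = k * log 2 →
      ww x t = 1 / k * (1 / log 2) + 1 / k ^ 2 * ((1 - t * (1 / x)) * (1 / log 2) ^ 2) := by
    intro k t h
    unfold ww
    rw [h]
    ring
  have e3 : ww x 3 = 1 / log 3 + (1 - 3 * (1 / x)) * (1 / log 3) ^ 2 := by
    unfold ww; ring
  rw [e3, e 2 4 l4, e 3 8 l8, e 4 16 l16, e 6 64 l64]
  generalize 1 / log 2 = y at *
  generalize 1 / log 3 = z at *
  generalize 1 / x = v at *
  have hz : 0.9099 ≤ z := by linarith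
  have hz2 : 0.8279 ≤ z ^ 2 := by nlinarith
  have hY1 : 2.081 ≤ y ^ 2 := by nlinarith
  have hY2 : y ^ 2 ≤ 2.0817 := by nlinarith
  have p3 := mul_le_mul_of_nonneg_left hz2 (show 0 ≤ 1 - 3 * v by linarith)
  have p4 := mul_le_mul_of_nonneg_left hY1 (show 0 ≤ 1 - 4 * v by linarith)
  have p8 := mul_le_mul_of_nonneg_left hY1 (show 0 ≤ 1 - 8 * v by linarith)
  have p16 := mul_le_mul_of_nonneg_left hY1 (show 0 ≤ 1 - 16 * v by linarith)
  have p64 := mul_le_mul_of_nonneg_left hY2 (show 0 ≤ 1 - 64 * v by linarith)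
  linarith

end IntPart

theorem integral_Pi_sub_li_div_sq_neg (x : ℝ) (hx : x > 2) :
    (∫ t in (2:ℝ)..x, (PiR t - li t) / t ^ 2) < 0 := by
  refine (main_le hx).trans_lt ?_
  have hl : 0 < Real.log x := Real.log_pos (by linarith)
  rcases lt_or_ge x 64 with h | h
  · have h1 : ∫ t in (2:ℝ)..x, Qf t * mm x t ≤ 0 * (ww x 2 - ww x x) := by
      apply step_le hx le_rfl hx.le le_rfl
      intro t ht1 ht2
      rcases eq_or_lt_of_le ht1 with rfl | h2
      · exact Qf_two_nonpos le_rfl (by norm_num)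
      · exact (Qf_neg h2 (by linarith)).le
    have h2 : Qf x / Real.log x < 0 := div_neg_of_neg_of_pos (Qf_neg hx h) hl
    linarith
  · have s0 := step_le (a := 2) (b := 3) (q := 0) hx (by norm_num) (by norm_num) (by linarith)
      (fun t a b => Qf_two_nonpos a b)
    have s1 := step_le (a := 3) (b := 4) hx (by norm_num) (by norm_num) (by linarith)
      (fun t a b => Qf_3 a b)
    have s2 := step_le (a := 4) (b := 8) hx (by norm_num) (by norm_num) (by linarith)
      (fun t a b => Qf_4 a b)
    have s3 := step_le (a := 8) (b := 16) hx (by norm_num) (by norm_num) (by linarith)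
      (fun t a b => Qf_8 a b)
    have s4 := step_le (a := 16) (b := 64) hx (by norm_num) (by norm_num) (by linarith)
      (fun t a b => Qf_16 a b)
    have s5 := step_le (a := 64) (b := x) hx (by norm_num) h le_rfl
      (fun t a b => Qf_large a)
    have ii : ∀ a b : ℝ, 2 ≤ a → a ≤ b → b ≤ x →
        IntervalIntegrable (fun t => Qf t * mm x t) volume a b := by
      intro a b h1 h2 h3
      apply (Qf_ii hx).mono_set
      rw [Set.uIcc_of_le h2, Set.uIcc_of_le hx.le]
      exact Set.Icc_subset_Icc h1 h3
    have j1 := intervalIntegral.integral_add_adjacent_intervals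
      (ii 2 3 (by norm_num) (by norm_num) (by linarith)) (ii 3 x (by norm_num) (by linarith) le_rfl)
    have j2 := intervalIntegral.integral_add_adjacent_intervals
      (ii 3 4 (by norm_num) (by norm_num) (by linarith)) (ii 4 x (by norm_num) (by linarith) le_rfl)
    have j3 := intervalIntegral.integral_add_adjacent_intervals
      (ii 4 8 (by norm_num) (by norm_num) (by linarith)) (ii 8 x (by norm_num) (by linarith) le_rfl)
    have j4 := intervalIntegral.integral_add_adjacent_intervals
      (ii 8 16 (by norm_num) (by norm_num) (by linarith)) (ii 16 x (by norm_num) (by linarith) le_rfl)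
    have j5 := intervalIntegral.integral_add_adjacent_intervals
      (ii 16 64 (by norm_num) (by norm_num) (by linarith)) (ii 64 x (by norm_num) (by linarith) le_rfl)
    have hQx : Qf x / Real.log x ≤ 397/1000 * ww x x := by
      rw [ww_self (by linarith), mul_one_div]
      exact div_le_div_of_nonneg_right (Qf_large h) hl.le
    have := final_num h
    linarith
end

section
/- Suppose 1/2 < ω ≤ 1, where ω = sup{Re(s) : ζ(s) = 0}, and let c be a real number with c < 1 + ω. Then there exist arbitrarily large x such that ∫_2^x (θ(t) − t)/t^c dt > 0. -/
open MeasureTheory Filter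

/-- `theta x = ∑_{p ≤ x} log p`, the Chebyshev theta function. -/
noncomputable def theta (x : ℝ) : ℝ :=
  ∑ p ∈ Finset.filter Nat.Prime (Finset.range (⌊x⌋₊ + 1)), Real.log p

/-- `omegaZ = sup {Re s : ζ(s) = 0}`. -/
noncomputable def omegaZ : ℝ := sSup {r : ℝ | ∃ s : ℂ, riemannZeta s = 0 ∧ s.re = r}

open Set Topology ProbabilityTheory in
lemma landau_aux {Ω : Type*} {m : MeasurableSpace Ω} (X : Ω → ℝ) (μ : Measure Ω)
    (hXm : Measurable X) (hX : ∀ᵐ w ∂μ, X w ≤ 0) (Φ : ℂ → ℂ) (σ₀ σ₁ : ℝ)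
    (hI : Ioi σ₁ ⊆ integrableExpSet X μ)
    (hΦ : ∀ y : ℝ, σ₀ < y → AnalyticAt ℂ Φ y)
    (heq : ∀ z : ℂ, σ₁ < z.re → Φ z = complexMGF X μ z) :
    Ioi σ₀ ⊆ integrableExpSet X μ := by
  intro σ hσ
  by_contra hσI
  set I := integrableExpSet X μ with hIdef
  have hup : ∀ a ∈ I, ∀ b, a ≤ b → b ∈ I := by
    intro a ha b hab
    have ha' : Integrable (fun w ↦ Real.exp (a * X w)) μ := ha
    refine Integrable.mono' ha' (by fun_prop) ?_
    filter_upwards [hX] with w hw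
    rw [Real.norm_of_nonneg (Real.exp_nonneg _)]
    exact Real.exp_le_exp.2 (by nlinarith)
  have hlb : ∀ a ∈ I, σ ≤ a := fun a ha ↦ by
    by_contra h
    exact hσI (hup a ha σ (not_le.1 h).le)
  have hne : I.Nonempty := ⟨σ₁ + 1, hI (by simp)⟩
  have hbdd : BddBelow I := ⟨σ, hlb⟩
  set b := sInf I with hb
  have hσb : σ ≤ b := le_csInf hne hlb
  have hbI : Ioi b ⊆ I := by
    intro x hx
    obtain ⟨a, ha, hax⟩ := exists_lt_of_csInf_lt hne hx
    exact hup a ha x hax.le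
  have hbint : Ioi b ⊆ interior I := interior_maximal hbI isOpen_Ioi
  -- agreement near the real axis
  have hagree : ∀ y : ℝ, b < y → Φ =ᶠ[𝓝 (y : ℂ)] complexMGF X μ := by
    have hpre : IsPreconnected ((fun y : ℝ ↦ (y : ℂ)) '' Ioi b) :=
      isPreconnected_Ioi.image _ (by fun_prop)
    have hE : EqOn Φ (complexMGF X μ) ((fun y : ℝ ↦ (y : ℂ)) '' Ioi b) := by
      refine AnalyticOnNhd.eqOn_of_preconnected_of_eventuallyEq (𝕜 := ℂ)
        (z₀ := ((max b σ₁ + 1 : ℝ) : ℂ)) ?_ ?_ hpre ?_ ?_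
      · rintro _ ⟨y, hy, rfl⟩
        exact hΦ y (lt_of_lt_of_le hσ (hσb.trans (le_of_lt hy)))
      · rintro _ ⟨y, hy, rfl⟩
        exact analyticAt_complexMGF (by simpa using hbint hy)
      · exact ⟨_, by simp [lt_of_le_of_lt (le_max_left b σ₁)], rfl⟩
      · have : {z : ℂ | σ₁ < z.re} ∈ 𝓝 ((max b σ₁ + 1 : ℝ) : ℂ) := by
          refine (isOpen_lt continuous_const Complex.continuous_re).mem_nhds ?_
          simp only [mem_ofPred_eq, Complex.ofReal_re]
          linarith [le_max_right b σ₁]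
        filter_upwards [this] with z hz using heq z hz
    intro y hy
    have h1 : AnalyticAt ℂ Φ y := hΦ y (lt_of_lt_of_le hσ (hσb.trans hy.le))
    have h2 : AnalyticAt ℂ (complexMGF X μ) y :=
      analyticAt_complexMGF (by simpa using hbint hy)
    refine (h1.frequently_eq_iff_eventually_eq h2).1 ?_
    have ht : Tendsto (fun x : ℝ ↦ (x : ℂ)) (𝓝[>] y) (𝓝[≠] (y : ℂ)) := by
      refine tendsto_nhdsWithin_iff.2 ⟨?_, ?_⟩
      · exact (Complex.continuous_ofReal.tendsto y).mono_left nhdsWithin_le_nhds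
      · filter_upwards [self_mem_nhdsWithin] with x hx
        simpa using (ne_of_gt hx)
    refine ht.frequently (Eventually.frequently ?_)
    filter_upwards [self_mem_nhdsWithin] with x hx
    exact hE ⟨x, lt_trans hy hx, rfl⟩
  -- Taylor expansion
  have hUb : {z : ℂ | AnalyticAt ℂ Φ z} ∈ 𝓝 (b : ℂ) :=
    (isOpen_analyticAt ℂ Φ).mem_nhds (hΦ b (lt_of_lt_of_le hσ hσb))
  obtain ⟨R, hR, hball⟩ := Metric.mem_nhds_iff.1 hUb
  set r := R / 3 with hr
  have hr0 : 0 < r := by positivity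
  set y := b + r with hy
  have hby : b < y := by linarith
  have hdiff : DifferentiableOn ℂ Φ (Metric.ball (y : ℂ) (2 * r)) := by
    intro z hz
    have : z ∈ Metric.ball (b : ℂ) R := by
      rw [Metric.mem_ball] at hz ⊢
      have h3 : dist (y : ℂ) (b : ℂ) = r := by
        rw [Complex.dist_of_im_eq (by simp)]; simp [hy, abs_of_pos hr0]
      have := dist_triangle z (y : ℂ) b
      linarith
    exact (hball this).differentiableAt.differentiableWithinAt
  set δ := 3 / 2 * r with hδ
  have hδ0 : 0 < δ := by positivity
  have hz : ((y - δ : ℝ) : ℂ) ∈ Metric.ball (y : ℂ) (2 * r) := by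
    rw [Metric.mem_ball, Complex.dist_of_im_eq (by simp)]
    simp [abs_of_pos hr0, hδ]; linarith
  have hsum := (Complex.hasSum_taylorSeries_on_ball hdiff hz).summable
  have hyint : y ∈ interior I := hbint hby
  set f : ℕ → Ω → ℝ := fun n w ↦ (δ * (-X w)) ^ n / n.factorial * Real.exp (y * X w) with hf
  have hfi : ∀ n, Integrable (f n) μ := by
    intro n
    have := (integrable_pow_mul_exp_of_mem_interior_integrableExpSet hyint n).const_mul
      ((-δ) ^ n / n.factorial)
    refine this.congr (ae_of_all _ fun w ↦ ?_)
    simp only [hf]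
    rw [show δ * -X w = (-δ) * X w by ring, mul_pow]; ring
  have hterm : ∀ n : ℕ, ((n.factorial : ℂ)⁻¹ • (((y - δ : ℝ) : ℂ) - y) ^ n •
      iteratedDeriv n Φ (y : ℂ)) = ((∫ w, f n w ∂μ : ℝ) : ℂ) := by
    intro n
    rw [(hagree y hby).iteratedDeriv_eq, iteratedDeriv_complexMGF (by simpa using hyint),
      ← integral_complex_ofReal]
    simp only [smul_eq_mul]
    rw [← mul_assoc, ← integral_const_mul]
    congr 1
    ext w
    simp only [hf]
    rw [show δ * -X w = (-δ) * X w by ring, mul_pow]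
    push_cast
    ring
  simp_rw [hterm] at hsum
  have hsum' : Summable (fun n ↦ ∫ w, f n w ∂μ) := Complex.summable_ofReal.1 hsum
  have hf0 : ∀ n, ∀ᵐ w ∂μ, 0 ≤ f n w := by
    intro n
    filter_upwards [hX] with w hw
    have : 0 ≤ -X w := by linarith
    simp only [hf]; positivity
  have hmem : y - δ ∈ I := by
    refine ⟨by fun_prop, ?_⟩
    rw [hasFiniteIntegral_iff_ofReal (ae_of_all _ fun w ↦ (Real.exp_pos _).le)]
    have h1 : ∫⁻ w, ENNReal.ofReal (Real.exp ((y - δ) * X w)) ∂μ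
        = ∫⁻ w, ∑' n, ENNReal.ofReal (f n w) ∂μ := by
      refine lintegral_congr_ae ?_
      filter_upwards [ae_all_iff.2 hf0] with w hw
      have hs : HasSum (fun n ↦ f n w) (Real.exp ((y - δ) * X w)) := by
        have := (NormedSpace.expSeries_div_hasSum_exp (δ * (-X w))).mul_right (Real.exp (y * X w))
        rw [← Real.exp_eq_exp_ℝ, ← Real.exp_add] at this
        rw [show (y - δ) * X w = δ * -X w + y * X w by ring]
        exact this
      rw [← ENNReal.ofReal_tsum_of_nonneg hw hs.summable, hs.tsum_eq]
    rw [h1, lintegral_tsum (fun n ↦ ((hfi n).1.aemeasurable.ennreal_ofReal))]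
    have h2 : ∀ n, ∫⁻ w, ENNReal.ofReal (f n w) ∂μ = ENNReal.ofReal (∫ w, f n w ∂μ) :=
      fun n ↦ (ofReal_integral_eq_lintegral_ofReal (hfi n) (hf0 n)).symm
    simp_rw [h2]
    rw [← ENNReal.ofReal_tsum_of_nonneg (fun n ↦ integral_nonneg_of_ae (hf0 n)) hsum']
    exact ENNReal.ofReal_lt_top
  have := csInf_le hbdd hmem
  linarith

open Set Topology Asymptotics in
lemma mellin_one_aux (f : ℝ → ℂ) (hf : LocallyIntegrableOn f (Ioi 0)) (r : ℝ)
    (hO : f =O[atTop] fun t : ℝ ↦ t ^ r) {z : ℂ} (hz : r < z.re) :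
    DifferentiableAt ℂ (fun z : ℂ ↦ ∫ t in Ioi (1 : ℝ), f t * (t : ℂ) ^ (-(z + 1))) z ∧
      IntegrableOn (fun t : ℝ ↦ f t * (t : ℂ) ^ (-(z + 1))) (Ioi 1) := by
  set g : ℝ → ℂ := indicator (Ioi 1) f with hg
  have hgl : LocallyIntegrableOn g (Ioi 0) := by
    intro x hx
    obtain ⟨u, hu, hi⟩ := hf x hx
    exact ⟨u, hu, hi.indicator measurableSet_Ioi⟩
  have hgt : g =O[atTop] fun t : ℝ ↦ t ^ (-(-r)) := by
    simp only [neg_neg]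
    refine hO.congr' ?_ EventuallyEq.rfl
    filter_upwards [eventually_gt_atTop 1] with t ht
    simp [hg, ht]
  have hgb : g =O[𝓝[>] 0] fun t : ℝ ↦ t ^ (-((-z).re - 1)) := by
    refine IsBigO.congr' (isBigO_zero _ _) ?_ EventuallyEq.rfl
    filter_upwards [Ioo_mem_nhdsGT (zero_lt_one' ℝ)] with t ht
    simp [hg, ht.2.le]
  have hmel : ∀ w : ℂ, mellin g (-w) = ∫ t in Ioi (1 : ℝ), f t * (t : ℂ) ^ (-(w + 1)) := by
    intro w
    have : (fun t : ℝ ↦ (t : ℂ) ^ (-w - 1) • g t) =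
        indicator (Ioi 1) (fun t : ℝ ↦ f t * (t : ℂ) ^ (-(w + 1))) := by
      ext t
      by_cases ht : t ∈ Ioi (1 : ℝ)
      · simp only [hg, indicator_of_mem ht, smul_eq_mul]
        rw [mul_comm]; ring_nf
      · simp only [hg, indicator_of_notMem ht, smul_zero]
    rw [mellin, this, setIntegral_indicator measurableSet_Ioi,
      inter_eq_right.2 (Ioi_subset_Ioi zero_le_one)]
  have hs1 : (-z).re < -r := by simpa using hz
  have hs2 : (-z).re - 1 < (-z).re := by linarith
  constructor
  · have h1 := mellin_differentiableAt_of_isBigO_rpow hgl hgt hs1 hgb hs2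
    have h2 : DifferentiableAt ℂ (fun w : ℂ ↦ mellin g (-w)) z :=
      DifferentiableAt.comp (f := fun w : ℂ ↦ -w) z h1 (by fun_prop)
    simpa only [hmel] using h2
  · have h1 : MellinConvergent g (-z) := mellinConvergent_of_isBigO_rpow hgl hgt hs1 hgb hs2
    unfold MellinConvergent at h1
    refine (IntegrableOn.mono_set h1 (Ioi_subset_Ioi zero_le_one)).congr_fun ?_ measurableSet_Ioi
    intro t ht
    simp only [hg, indicator_of_mem ht, smul_eq_mul]
    rw [mul_comm]; ring_nf

open Set in
lemma integral_id_aux {z : ℂ} (hz : 1 < z.re) :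
    IntegrableOn (fun t : ℝ ↦ (t : ℂ) * (t : ℂ) ^ (-(z + 1))) (Ioi 1) ∧
    ∫ t in Ioi (1 : ℝ), (t : ℂ) * (t : ℂ) ^ (-(z + 1)) = 1 / (z - 1) := by
  have he : EqOn (fun t : ℝ ↦ (t : ℂ) ^ (-z)) (fun t : ℝ ↦ (t : ℂ) * (t : ℂ) ^ (-(z + 1)))
      (Ioi 1) := by
    intro t ht
    have ht0 : (t : ℂ) ≠ 0 := by
      have : (1 : ℝ) < t := ht
      exact_mod_cast (by linarith : t ≠ 0)
    simp only
    rw [show -z = 1 + (-(z + 1)) by ring, Complex.cpow_add _ _ ht0, Complex.cpow_one]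
  constructor
  · exact (integrableOn_Ioi_cpow_of_lt (by simpa using hz) one_pos).congr_fun he measurableSet_Ioi
  · rw [← setIntegral_congr_fun measurableSet_Ioi he,
      integral_Ioi_cpow_of_lt (by simpa using hz) one_pos]
    have h : z - 1 ≠ 0 := fun h ↦ by
      have := congrArg Complex.re h
      simp at this; linarith
    have h' : -z + 1 ≠ 0 := fun h' ↦ h (by linear_combination -h')
    simp
    field_simp
    ring

open Set Topology Asymptotics in
lemma zeta_one_formula {z : ℂ} (hz : 0 < z.re) :
    riemannZeta₁ z = z - z * (z - 1) *
      ∫ t in Ioi (1 : ℝ), ((Int.fract t : ℝ) : ℂ) * (t : ℂ) ^ (-(z + 1)) := by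
  have hli : LocallyIntegrableOn (fun t : ℝ ↦ ((Int.fract t : ℝ) : ℂ)) (Ioi 0) := by
    have : LocallyIntegrable (fun t : ℝ ↦ ((Int.fract t : ℝ) : ℂ)) := by
      refine (locallyIntegrable_const (1 : ℝ)).mono (by fun_prop) (ae_of_all _ fun t ↦ ?_)
      simp [abs_of_nonneg (Int.fract_nonneg t), (Int.fract_lt_one t).le]
    exact this.locallyIntegrableOn _
  have hO : (fun t : ℝ ↦ ((Int.fract t : ℝ) : ℂ)) =O[atTop] fun t : ℝ ↦ t ^ (0 : ℝ) := by
    refine IsBigO.of_bound 1 (Eventually.of_forall fun t ↦ ?_)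
    simp [abs_of_nonneg (Int.fract_nonneg t), (Int.fract_lt_one t).le]
  have hU : IsOpen {z : ℂ | 0 < z.re} := isOpen_lt continuous_const Complex.continuous_re
  have hE : EqOn riemannZeta₁ (fun z ↦ z - z * (z - 1) *
      ∫ t in Ioi (1 : ℝ), ((Int.fract t : ℝ) : ℂ) * (t : ℂ) ^ (-(z + 1))) {z : ℂ | 0 < z.re} := by
    refine AnalyticOnNhd.eqOn_of_preconnected_of_eventuallyEq (𝕜 := ℂ) (z₀ := 2) ?_ ?_
      (convex_halfSpace_re_gt 0).isPreconnected (by simp) ?_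
    · exact differentiable_riemannZeta₁.differentiableOn.analyticOnNhd hU
    · refine DifferentiableOn.analyticOnNhd (fun w hw ↦ ?_) hU
      have := (mellin_one_aux _ hli 0 hO hw).1
      exact DifferentiableAt.differentiableWithinAt (by fun_prop)
    · have : {z : ℂ | 1 < z.re} ∈ 𝓝 (2 : ℂ) :=
        (isOpen_lt continuous_const Complex.continuous_re).mem_nhds (by simp)
      filter_upwards [this] with w hw
      have hw : 1 < w.re := hw
      have hw1 : w ≠ 1 := by rintro rfl; simp at hw
      have h1 := LSeries_eq_mul_integral_of_nonneg (fun _ ↦ 1) zero_le_one (s := w) hw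
        (by
          simp only [Finset.sum_const, Nat.card_Icc, Real.rpow_one]
          simpa using isBigO_refl _ _) (fun _ ↦ zero_le_one)
      have h2 := LSeries_one_eq_riemannZeta hw
      have h3 : LSeries (fun n ↦ ((1 : ℝ) : ℂ)) w = riemannZeta w := by
        rw [← h2]; congr 1
      rw [h3] at h1
      obtain ⟨i1, i2⟩ := integral_id_aux hw
      have i3 := (mellin_one_aux _ hli 0 hO (z := w) (by linarith)).2
      have h4 : ∫ t in Ioi (1 : ℝ), (∑ k ∈ Finset.Icc 1 ⌊t⌋₊, ((1 : ℝ) : ℂ)) * (t : ℂ) ^ (-(w + 1))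
          = 1 / (w - 1) - ∫ t in Ioi (1 : ℝ), ((Int.fract t : ℝ) : ℂ) * (t : ℂ) ^ (-(w + 1)) := by
        rw [← i2, ← integral_sub i1 i3]
        refine setIntegral_congr_fun measurableSet_Ioi fun t ht ↦ ?_
        have ht0 : (0 : ℝ) ≤ t := by have : (1 : ℝ) < t := ht; linarith
        have : ((⌊t⌋₊ : ℝ) : ℂ) = (t : ℂ) - ((Int.fract t : ℝ) : ℂ) := by
          rw [natCast_floor_eq_intCast_floor ht0, Int.fract]; push_cast; ring
        simp at this ⊢
        rw [this]; ring
      rw [h4] at h1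
      have h5 := riemannZeta_eq_inv_sub_mul hw1
      have hw1' : w - 1 ≠ 0 := sub_ne_zero.2 hw1
      have h6 : riemannZeta₁ w = (w - 1) * riemannZeta w := by rw [h5]; field_simp
      rw [h6, h1]
      field_simp
  exact hE hz

open Set in
lemma zeta_one_real_ne_zero {σ : ℝ} (hσ : 0 < σ) : riemannZeta₁ σ ≠ 0 := by
  rcases lt_or_ge σ 1 with h | h
  · rw [zeta_one_formula (by simpa using hσ)]
    have h1 : ∫ t in Ioi (1 : ℝ), ((Int.fract t : ℝ) : ℂ) * (t : ℂ) ^ (-((σ : ℂ) + 1)) =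
        ((∫ t in Ioi (1 : ℝ), Int.fract t * t ^ (-(σ + 1)) : ℝ) : ℂ) := by
      rw [← integral_complex_ofReal]
      refine setIntegral_congr_fun measurableSet_Ioi fun t ht ↦ ?_
      have ht0 : (0 : ℝ) ≤ t := by have : (1 : ℝ) < t := ht; linarith
      push_cast
      rw [Complex.ofReal_cpow ht0]
      push_cast
      rfl
    have h2 : 0 ≤ ∫ t in Ioi (1 : ℝ), Int.fract t * t ^ (-(σ + 1)) := by
      refine setIntegral_nonneg measurableSet_Ioi fun t ht ↦ ?_
      have ht0 : (0 : ℝ) ≤ t := by have : (1 : ℝ) < t := ht; linarith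
      have := Int.fract_nonneg t
      positivity
    rw [h1]
    set D := ∫ t in Ioi (1 : ℝ), Int.fract t * t ^ (-(σ + 1))
    have : (σ : ℂ) - σ * (σ - 1) * (D : ℂ) = ((σ + σ * (1 - σ) * D : ℝ) : ℂ) := by
      push_cast; ring
    rw [this]
    have : 0 < σ + σ * (1 - σ) * D := by
      have : 0 < 1 - σ := by linarith
      positivity
    exact_mod_cast this.ne'
  · rcases h.eq_or_lt with rfl | h
    · simp
    · have hs : (σ : ℂ) ≠ 1 := by exact_mod_cast h.ne'
      intro h0
      have := riemannZeta_eq_inv_sub_mul hs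
      rw [h0, mul_zero] at this
      exact riemannZeta_ne_zero_of_one_le_re (by simpa using h.le) this

open Set in
lemma fubini_aux (h : ℝ → ℝ) (hm : Measurable h) (s : ℂ) (hs : 0 < s.re)
    (hi : IntegrableOn (fun t : ℝ ↦ (h t : ℂ) * (t : ℂ) ^ (-s)) (Ioi 1)) :
    IntegrableOn (fun x : ℝ ↦ ((∫ t in (1 : ℝ)..x, h t : ℝ) : ℂ) * (x : ℂ) ^ (-(s + 1))) (Ioi 1) ∧
    s * ∫ x in Ioi (1 : ℝ), ((∫ t in (1 : ℝ)..x, h t : ℝ) : ℂ) * (x : ℂ) ^ (-(s + 1)) =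
      ∫ t in Ioi (1 : ℝ), (h t : ℂ) * (t : ℂ) ^ (-s) := by
  have hs0 : s ≠ 0 := by rintro rfl; simp at hs
  set μ : Measure ℝ := volume.restrict (Ioi 1) with hμ
  set K : ℝ × ℝ → ℂ :=
    indicator {p : ℝ × ℝ | p.1 < p.2} (fun p ↦ (h p.1 : ℂ) * (p.2 : ℂ) ^ (-(s + 1))) with hK
  have hKm : Measurable K := by
    refine Measurable.indicator ?_ (measurableSet_lt measurable_fst measurable_snd)
    fun_prop
  have hK1 : ∀ t : ℝ, (fun x ↦ K (t, x)) =
      indicator (Ioi t) (fun x : ℝ ↦ (h t : ℂ) * (x : ℂ) ^ (-(s + 1))) := by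
    intro t; ext x
    by_cases hx : t < x
    · simp [hK, hx]
    · simp [hK, hx]
  have hK2 : ∀ x : ℝ, (fun t ↦ K (t, x)) =
      indicator (Iio x) (fun t : ℝ ↦ (h t : ℂ) * (x : ℂ) ^ (-(s + 1))) := by
    intro x; ext t
    by_cases hx : t < x
    · simp [hK, hx]
    · simp [hK, hx]
  have hre : (-(s + 1)).re < -1 := by simp; linarith
  have hinner : ∀ t : ℝ, 1 < t → ∫ x, K (t, x) ∂μ = s⁻¹ * ((h t : ℂ) * (t : ℂ) ^ (-s)) := by
    intro t ht
    rw [hK1, hμ, setIntegral_indicator measurableSet_Ioi, inter_eq_right.2 (Ioi_subset_Ioi ht.le),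
      integral_const_mul, integral_Ioi_cpow_of_lt hre (by linarith)]
    rw [show -(s + 1) + 1 = -s by ring]
    field_simp
  have hinnerN : ∀ t : ℝ, 1 < t →
      ∫ x, ‖K (t, x)‖ ∂μ = s.re⁻¹ * ‖(h t : ℂ) * (t : ℂ) ^ (-s)‖ := by
    intro t ht
    have e1 : (fun x ↦ ‖K (t, x)‖) = indicator (Ioi t)
        (fun x : ℝ ↦ ‖(h t : ℂ)‖ * ‖(x : ℂ) ^ (-(s + 1))‖) := by
      ext x
      have := congrFun (hK1 t) x
      rw [this, norm_indicator_eq_indicator_norm]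
      simp
    rw [e1, hμ, setIntegral_indicator measurableSet_Ioi, inter_eq_right.2 (Ioi_subset_Ioi ht.le),
      integral_const_mul]
    have e2 : ∫ x in Ioi t, ‖(x : ℂ) ^ (-(s + 1))‖ = ∫ x in Ioi t, x ^ (-(s.re + 1)) := by
      refine setIntegral_congr_fun measurableSet_Ioi fun x hx ↦ ?_
      have hx' : t < x := hx
      rw [Complex.norm_cpow_eq_rpow_re_of_pos (by linarith)]
      simp
    rw [e2, integral_Ioi_rpow_of_lt (by linarith) (by linarith), norm_mul,
      Complex.norm_cpow_eq_rpow_re_of_pos (by linarith)]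
    rw [show -(s.re + 1) + 1 = -s.re by ring]
    simp only [Complex.neg_re]
    field_simp
  have hKint : Integrable K (μ.prod μ) := by
    rw [integrable_prod_iff hKm.aestronglyMeasurable]
    constructor
    · filter_upwards [ae_restrict_mem measurableSet_Ioi] with t ht
      have ht : 1 < t := ht
      rw [hK1, integrable_indicator_iff measurableSet_Ioi, hμ, IntegrableOn,
        Measure.restrict_restrict measurableSet_Ioi, inter_eq_left.2 (Ioi_subset_Ioi ht.le)]
      exact (integrableOn_Ioi_cpow_of_lt hre (by linarith)).const_mul _
    · refine (hi.norm.const_mul (s.re⁻¹)).congr ?_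
      filter_upwards [ae_restrict_mem measurableSet_Ioi] with t ht
      exact (hinnerN t ht).symm
  have houter : ∀ x : ℝ, 1 < x → ∫ t, K (t, x) ∂μ =
      ((∫ t in (1 : ℝ)..x, h t : ℝ) : ℂ) * (x : ℂ) ^ (-(s + 1)) := by
    intro x hx
    rw [hK2, hμ, setIntegral_indicator measurableSet_Iio, Ioi_inter_Iio, integral_mul_const,
      integral_complex_ofReal, intervalIntegral.integral_of_le hx.le, integral_Ioc_eq_integral_Ioo]
  have hcongr : (fun x ↦ ∫ t, K (t, x) ∂μ) =ᵐ[μ]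
      fun x : ℝ ↦ ((∫ t in (1 : ℝ)..x, h t : ℝ) : ℂ) * (x : ℂ) ^ (-(s + 1)) := by
    filter_upwards [ae_restrict_mem measurableSet_Ioi] with x hx using houter x hx
  have hcongr' : (fun t ↦ ∫ x, K (t, x) ∂μ) =ᵐ[μ]
      fun t : ℝ ↦ s⁻¹ * ((h t : ℂ) * (t : ℂ) ^ (-s)) := by
    filter_upwards [ae_restrict_mem measurableSet_Ioi] with x hx using hinner x hx
  refine ⟨hKint.integral_prod_right.congr hcongr, ?_⟩
  have := integral_prod_symm K hKint
  rw [integral_prod K hKint, integral_congr_ae hcongr, integral_congr_ae hcongr',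
    integral_const_mul] at this
  rw [← this]
  field_simp

lemma theta_eq_chebyshev (x : ℝ) : theta x = Chebyshev.theta x := by
  rw [theta, Chebyshev.theta_eq_sum_Icc]
  congr 1
  ext n
  simp

/-- The Mellin transform of `ψ - θ`. -/
noncomputable def psiThetaTransform (z : ℂ) : ℂ :=
  ∫ t in Set.Ioi (1 : ℝ), ((Chebyshev.psi t - Chebyshev.theta t : ℝ) : ℂ) * (t : ℂ) ^ (-(z + 1))

open Set Asymptotics in
lemma psiTheta_aux {z : ℂ} (hz : 1 / 2 < z.re) : DifferentiableAt ℂ psiThetaTransform z ∧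
    IntegrableOn (fun t : ℝ ↦ ((Chebyshev.psi t - Chebyshev.theta t : ℝ) : ℂ) *
      (t : ℂ) ^ (-(z + 1))) (Ioi 1) := by
  refine mellin_one_aux (fun t ↦ ((Chebyshev.psi t - Chebyshev.theta t : ℝ) : ℂ)) ?_ (1 / 2) ?_ hz
  · refine LocallyIntegrable.locallyIntegrableOn ?_ _
    intro x
    obtain ⟨u, hu, hi⟩ := ((Chebyshev.psi_mono.locallyIntegrable (μ := volume)).sub
      (Chebyshev.theta_mono.locallyIntegrable)) x
    exact ⟨u, hu, hi.ofReal⟩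
  · have := Chebyshev.isBigO_psi_sub_theta_sqrt
    rw [← isBigO_norm_left] at this ⊢
    refine (this.congr_left fun t ↦ ?_).congr_right fun t ↦ Real.sqrt_eq_rpow t
    simp [-Complex.ofReal_sub, Complex.norm_real]

open Set Asymptotics in
lemma psi_aux {z : ℂ} (hz : 1 < z.re) :
    IntegrableOn (fun t : ℝ ↦ ((Chebyshev.psi t : ℝ) : ℂ) * (t : ℂ) ^ (-(z + 1))) (Ioi 1) ∧
    z * ∫ t in Ioi (1 : ℝ), ((Chebyshev.psi t : ℝ) : ℂ) * (t : ℂ) ^ (-(z + 1)) =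
      -deriv riemannZeta z / riemannZeta z := by
  have hO : (Chebyshev.psi) =O[atTop] fun t : ℝ ↦ t ^ (1 : ℝ) := by
    refine IsBigO.of_bound (Real.log 4 + 4) ?_
    filter_upwards [eventually_ge_atTop 0] with t ht
    rw [Real.norm_of_nonneg (Chebyshev.psi_nonneg t), Real.rpow_one, Real.norm_of_nonneg ht]
    exact Chebyshev.psi_le_const_mul_self ht
  constructor
  · refine (mellin_one_aux (fun t ↦ ((Chebyshev.psi t : ℝ) : ℂ)) ?_ 1 ?_ hz).2
    · refine LocallyIntegrable.locallyIntegrableOn ?_ _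
      intro x
      obtain ⟨u, hu, hi⟩ := (Chebyshev.psi_mono.locallyIntegrable (μ := volume)) x
      exact ⟨u, hu, hi.ofReal⟩
    · rw [← isBigO_norm_left] at hO ⊢
      simpa only [Complex.norm_real] using hO
  · rw [← ArithmeticFunction.LSeries_vonMangoldt_eq_deriv_riemannZeta_div hz]
    rw [LSeries_eq_mul_integral_of_nonneg (fun n ↦ ArithmeticFunction.vonMangoldt n)
      zero_le_one hz ?_ (fun _ ↦ ArithmeticFunction.vonMangoldt_nonneg)]
    · congr 1
      refine setIntegral_congr_fun measurableSet_Ioi fun t ht ↦ ?_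
      simp only [Chebyshev.psi]
      push_cast
      rfl
    · refine (hO.comp_tendsto tendsto_natCast_atTop_atTop).congr_left fun n ↦ ?_
      simp [Chebyshev.psi]
      rfl

open Set in
lemma theta_transform {z : ℂ} (hz : 1 < z.re) :
    IntegrableOn (fun t : ℝ ↦ ((theta t - t : ℝ) : ℂ) * (t : ℂ) ^ (-(z + 1))) (Ioi 1) ∧
    ∫ t in Ioi (1 : ℝ), ((theta t - t : ℝ) : ℂ) * (t : ℂ) ^ (-(z + 1)) =
      - z⁻¹ - deriv riemannZeta₁ z / (z * riemannZeta₁ z) - psiThetaTransform z := by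
  obtain ⟨a1, a2⟩ := psi_aux hz
  obtain ⟨b1, b2⟩ := integral_id_aux hz
  have c1 := (psiTheta_aux (z := z) (by linarith)).2
  have he : (fun t : ℝ ↦ ((theta t - t : ℝ) : ℂ) * (t : ℂ) ^ (-(z + 1))) = fun t : ℝ ↦
      ((Chebyshev.psi t : ℝ) : ℂ) * (t : ℂ) ^ (-(z + 1)) - (t : ℂ) * (t : ℂ) ^ (-(z + 1)) -
      ((Chebyshev.psi t - Chebyshev.theta t : ℝ) : ℂ) * (t : ℂ) ^ (-(z + 1)) := by
    ext t
    rw [theta_eq_chebyshev]; push_cast; ring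
  rw [he]
  have d1 : IntegrableOn (fun t : ℝ ↦ ((Chebyshev.psi t : ℝ) : ℂ) * (t : ℂ) ^ (-(z + 1)) -
      (t : ℂ) * (t : ℂ) ^ (-(z + 1))) (Ioi 1) := a1.sub b1
  refine ⟨d1.sub c1, ?_⟩
  rw [integral_sub d1 c1, integral_sub a1 b1, b2, psiThetaTransform]
  congr 1
  have hz0 : z ≠ 0 := by rintro rfl; simp at hz; linarith
  have hz1 : z ≠ 1 := by rintro rfl; simp at hz
  have hz1' : z - 1 ≠ 0 := sub_ne_zero.2 hz1
  have hζ : riemannZeta z ≠ 0 := riemannZeta_ne_zero_of_one_le_re hz.le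
  have h1 : riemannZeta₁ z = (z - 1) * riemannZeta z := by
    rw [riemannZeta_eq_inv_sub_mul hz1]; field_simp
  have h2 : deriv riemannZeta₁ z = riemannZeta z + (z - 1) * deriv riemannZeta z := by
    have hev : riemannZeta₁ =ᶠ[nhds z] fun w ↦ (w - 1) * riemannZeta w := by
      filter_upwards [isOpen_ne.mem_nhds hz1] with w hw
      have : w - 1 ≠ 0 := sub_ne_zero.2 hw
      rw [riemannZeta_eq_inv_sub_mul hw]; field_simp
    rw [hev.deriv_eq]
    have hd := (((hasDerivAt_id z).sub_const 1).mul (differentiableAt_riemannZeta hz1).hasDerivAt)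
    have := hd.deriv
    simp at this
    rw [← this]; rfl
  have h3 : ∫ t in Ioi (1 : ℝ), ((Chebyshev.psi t : ℝ) : ℂ) * (t : ℂ) ^ (-(z + 1)) =
      z⁻¹ * (-deriv riemannZeta z / riemannZeta z) := by
    rw [← a2]; field_simp
  rw [h3, h1, h2]
  field_simp
  ring

open Set Topology in
lemma ord_aux (f K : ℂ → ℂ) (ρ : ℂ) (hf : AnalyticAt ℂ f ρ) (hK : AnalyticAt ℂ K ρ)
    (h0 : f ρ = 0) (heq : deriv f =ᶠ[𝓝 ρ] fun z ↦ f z * K z) : f =ᶠ[𝓝 ρ] fun _ ↦ 0 := by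
  have h1 := hf.analyticOrderAt_deriv_add_one
  have h2 : analyticOrderAt (deriv f) ρ = analyticOrderAt f ρ + analyticOrderAt K ρ := by
    rw [analyticOrderAt_congr heq]
    exact analyticOrderAt_mul hf hK
  simp only [h0, sub_zero] at h1
  by_contra hne
  have h3 : analyticOrderAt f ρ ≠ ⊤ := by
    rw [Ne, analyticOrderAt_eq_top]; exact hne
  rw [h2] at h1
  have h4 : analyticOrderAt f ρ + 1 ≤ analyticOrderAt f ρ := by
    conv_rhs => rw [← h1]
    gcongr
    exact le_self_add
  exact absurd h4 (not_le.2 ((ENat.lt_add_one_iff h3).2 le_rfl))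

open Set Topology ProbabilityTheory Asymptotics in
lemma main_aux (F : ℝ → ℝ) (hFc : Continuous F) (X₀ : ℝ) (hX₀ : 1 ≤ X₀)
    (hF : ∀ x, X₀ < x → F x ≤ 0) (c F₁ : ℝ) (hc : c < 2)
    (hM : ∀ z : ℂ, 1 < z.re →
      IntegrableOn (fun x : ℝ ↦ (F x : ℂ) * (x : ℂ) ^ (-(z + 2 - c))) (Ioi 1) ∧
      (z + 1 - c) * ∫ x in Ioi (1 : ℝ), (F x : ℂ) * (x : ℂ) ^ (-(z + 2 - c)) =
        F₁ - z⁻¹ - deriv riemannZeta₁ z / (z * riemannZeta₁ z) - psiThetaTransform z)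
    (ρ : ℂ) (hρ : max (c - 1) (1 / 2) < ρ.re) : riemannZeta₁ ρ ≠ 0 := by
  set σ₀ := max (c - 1) (1 / 2) with hσ₀
  have hσ₀1 : σ₀ < 1 := by rw [hσ₀]; exact max_lt (by linarith) (by norm_num)
  -- the compact part
  set f : ℝ → ℂ := indicator (Iic X₀) (fun t : ℝ ↦ (F t : ℂ) * (t : ℂ) ^ ((c : ℂ) - 1)) with hf
  have hfl : LocallyIntegrableOn f (Ioi 0) := by
    have h1 : LocallyIntegrableOn (fun t : ℝ ↦ (F t : ℂ) * (t : ℂ) ^ ((c : ℂ) - 1)) (Ioi 0) := by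
      refine ContinuousOn.locallyIntegrableOn ?_ measurableSet_Ioi
      intro t ht
      refine ContinuousAt.continuousWithinAt ?_
      refine ContinuousAt.mul (by fun_prop) ?_
      exact (Complex.continuousAt_ofReal_cpow_const _ _ (Or.inr (ne_of_gt ht)))
    intro x hx
    obtain ⟨u, hu, hi⟩ := h1 x hx
    exact ⟨u, hu, hi.indicator measurableSet_Iic⟩
  have hfO : ∀ r : ℝ, f =O[atTop] fun t : ℝ ↦ t ^ r := by
    intro r
    refine IsBigO.congr' (isBigO_zero _ _) ?_ EventuallyEq.rfl
    filter_upwards [eventually_gt_atTop X₀] with t ht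
    simp [hf, ht]
  set E : ℂ → ℂ := fun z ↦ ∫ t in Ioi (1 : ℝ), f t * (t : ℂ) ^ (-(z + 1)) with hE
  have hEd : Differentiable ℂ E := fun z ↦
    (mellin_one_aux f hfl (z.re - 1) (hfO _) (z := z) (by linarith)).1
  -- the measure
  set d : ℝ → NNReal := fun x ↦ Real.toNNReal (-F x * x ^ (c - 2)) with hd
  have hdm : Measurable d := by
    refine Measurable.real_toNNReal ?_
    exact (hFc.neg.measurable).mul (by fun_prop)
  set μ : Measure ℝ := (volume.restrict (Ioi X₀)).withDensity (fun x ↦ (d x : ENNReal)) with hμ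
  set L : ℝ → ℝ := fun x ↦ -Real.log x with hL
  have hLm : Measurable L := Real.measurable_log.neg
  have hL0 : ∀ᵐ x ∂μ, L x ≤ 0 := by
    refine (withDensity_absolutelyContinuous _ _).ae_le ?_
    filter_upwards [ae_restrict_mem measurableSet_Ioi] with x hx
    have : 0 ≤ Real.log x := Real.log_nonneg (hX₀.trans (le_of_lt hx))
    simp only [hL]; linarith
  have hdv : ∀ x, X₀ < x → ((d x : NNReal) : ℝ) = -F x * x ^ (c - 2) := by
    intro x hx
    refine Real.coe_toNNReal _ (mul_nonneg (by linarith [hF x hx]) ?_)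
    exact Real.rpow_nonneg (by linarith) _
  have hpt : ∀ z : ℂ, ∀ x, X₀ < x → d x • Complex.exp (z * L x) =
      -((F x : ℂ) * (x : ℂ) ^ (-(z + 2 - c))) := by
    intro z x hx
    have hx0 : 0 < x := by linarith
    have hxc : (x : ℂ) ≠ 0 := by exact_mod_cast hx0.ne'
    rw [NNReal.smul_def, hdv x hx, Complex.real_smul]
    have e1 : Complex.exp (z * L x) = (x : ℂ) ^ (-z) := by
      rw [Complex.cpow_def_of_ne_zero hxc, ← Complex.ofReal_log hx0.le]
      congr 1
      simp only [hL]; push_cast; ring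
    rw [e1]
    push_cast
    rw [Complex.ofReal_cpow hx0.le]
    push_cast
    rw [show -(z + 2 - c : ℂ) = (c - 2) + (-z) by ring, Complex.cpow_add _ _ hxc]
    ring
  have hsub : Ioi X₀ ⊆ Ioi 1 := Ioi_subset_Ioi hX₀
  have hI : Ioi (1 : ℝ) ⊆ integrableExpSet L μ := by
    intro σ hσ
    have hi := ((hM σ (by simpa using hσ)).1.mono_set hsub).norm
    change Integrable _ μ
    rw [hμ, integrable_withDensity_iff_integrable_smul hdm]
    refine Integrable.congr hi ?_
    filter_upwards [ae_restrict_mem measurableSet_Ioi] with x hx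
    have h1 := hpt σ x hx
    rw [← norm_neg, ← h1]
    rw [NNReal.smul_def, NNReal.smul_def, norm_smul, Real.norm_of_nonneg (by positivity)]
    rw [← Complex.ofReal_mul, ← Complex.ofReal_exp, Complex.norm_real,
      Real.norm_of_nonneg (Real.exp_nonneg _)]
    rfl
  have hN : ∀ z : ℂ, complexMGF L μ z =
      -∫ x in Ioi X₀, (F x : ℂ) * (x : ℂ) ^ (-(z + 2 - c)) := by
    intro z
    rw [complexMGF, hμ, integral_withDensity_eq_integral_smul hdm, ← integral_neg]
    exact setIntegral_congr_fun measurableSet_Ioi fun x hx ↦ hpt z x hx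
  have hEv : ∀ z : ℂ, E z = ∫ x in Ioc 1 X₀, (F x : ℂ) * (x : ℂ) ^ (-(z + 2 - c)) := by
    intro z
    have e1 : E z = ∫ x in Ioi (1 : ℝ), indicator (Iic X₀)
        (fun x : ℝ ↦ (F x : ℂ) * (x : ℂ) ^ (-(z + 2 - c))) x := by
      refine setIntegral_congr_fun measurableSet_Ioi fun x hx ↦ ?_
      have hx1 : 1 < x := hx
      have hxc : (x : ℂ) ≠ 0 := by exact_mod_cast (by linarith : x ≠ 0)
      by_cases hxX : x ≤ X₀
      · simp only [hf, indicator_of_mem (show x ∈ Iic X₀ from hxX)]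
        rw [show -(z + 2 - c : ℂ) = (c - 1) + (-(z + 1)) by ring, Complex.cpow_add _ _ hxc]
        ring
      · simp [hf, hxX]
    rw [e1, setIntegral_indicator measurableSet_Iic, Ioi_inter_Iic]
  have hsplit : ∀ z : ℂ, 1 < z.re →
      ∫ x in Ioi (1 : ℝ), (F x : ℂ) * (x : ℂ) ^ (-(z + 2 - c)) = E z - complexMGF L μ z := by
    intro z hz
    rw [hEv, hN, sub_neg_eq_add, ← setIntegral_union (Ioc_disjoint_Ioi le_rfl) measurableSet_Ioi
      ((hM z hz).1.mono_set Ioc_subset_Ioi_self) ((hM z hz).1.mono_set hsub),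
      Ioc_union_Ioi_eq_Ioi hX₀]
  have hz1ne : ∀ z : ℂ, 1 < z.re → riemannZeta₁ z ≠ 0 := by
    intro z hz
    have hz1 : z ≠ 1 := by rintro rfl; simp at hz
    have := riemannZeta_ne_zero_of_one_le_re hz.le
    rw [riemannZeta_eq_inv_sub_mul hz1] at this
    exact (mul_ne_zero_iff.1 this).2
  have hopen : ∀ a : ℝ, IsOpen {z : ℂ | a < z.re} := fun a ↦
    isOpen_lt continuous_const Complex.continuous_re
  have hBan : ∀ z : ℂ, 1 / 2 < z.re → AnalyticAt ℂ psiThetaTransform z := by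
    intro z hz
    refine DifferentiableOn.analyticAt (s := {z : ℂ | 1 / 2 < z.re}) ?_ ((hopen _).mem_nhds hz)
    exact fun w hw ↦ (psiTheta_aux hw).1.differentiableWithinAt
  have hζan : ∀ z, AnalyticAt ℂ riemannZeta₁ z := fun z ↦
    differentiable_riemannZeta₁.analyticAt z
  have hEan : ∀ z, AnalyticAt ℂ E z := fun z ↦ hEd.analyticAt z
  set Φ : ℂ → ℂ := fun z ↦ E z - (F₁ - z⁻¹ - deriv riemannZeta₁ z / (z * riemannZeta₁ z) -
    psiThetaTransform z) / (z + 1 - c) with hΦ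
  have hland : Ioi σ₀ ⊆ integrableExpSet L μ := by
    refine landau_aux L μ hLm hL0 Φ σ₀ 1 hI ?_ ?_
    · intro y hy
      have hy1 : c - 1 < y := lt_of_le_of_lt (le_max_left _ _) hy
      have hy2 : 1 / 2 < y := lt_of_le_of_lt (le_max_right _ _) hy
      have h1 : (y : ℂ) ≠ 0 := by exact_mod_cast (by linarith : y ≠ 0)
      have h2 : (y : ℂ) + 1 - c ≠ 0 := by
        exact_mod_cast (by linarith : y + 1 - c ≠ 0)
      have h3 : riemannZeta₁ y ≠ 0 := zeta_one_real_ne_zero (by linarith)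
      have h4 := hBan y (by simpa using hy2)
      have h5 := (hζan y).deriv
      have h6 := hζan y
      have h7 := hEan y
      have h8 : (y : ℂ) * riemannZeta₁ y ≠ 0 := mul_ne_zero h1 h3
      refine h7.sub (AnalyticAt.div (((analyticAt_const.sub (analyticAt_id.inv h1)).sub
        (h5.div (analyticAt_id.mul h6) h8)).sub h4) ?_ h2)
      fun_prop
    · intro z hz
      have h2 : z + 1 - c ≠ 0 := by
        intro h
        have := congrArg Complex.re h
        simp at this
        linarith
      simp only [hΦ]
      rw [← (hM z hz).2, hsplit z hz]
      field_simp
      ring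
  have hNan : ∀ z : ℂ, σ₀ < z.re → AnalyticAt ℂ (complexMGF L μ) z := fun z hz ↦
    analyticAt_complexMGF (interior_maximal hland isOpen_Ioi hz)
  set K : ℂ → ℂ := fun z ↦ (complexMGF L μ z - E z) * (z * (z + 1 - c)) + F₁ * z - 1 -
    z * psiThetaTransform z with hK
  have hKan : ∀ z : ℂ, σ₀ < z.re → AnalyticAt ℂ K z := by
    intro z hz
    have h1 := hNan z hz
    have h2 := hBan z (lt_of_le_of_lt (le_max_right _ _) hz)
    have h3 := hEan z
    simp only [hK]
    fun_prop
  have hEq : EqOn (deriv riemannZeta₁) (fun z ↦ riemannZeta₁ z * K z) {z : ℂ | σ₀ < z.re} := by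
    refine AnalyticOnNhd.eqOn_of_preconnected_of_eventuallyEq (𝕜 := ℂ) (z₀ := 2)
      (fun z _ ↦ (hζan z).deriv) (fun z hz ↦ (hζan z).mul (hKan z hz))
      (convex_halfSpace_re_gt σ₀).isPreconnected ?_ ?_
    · simp; linarith
    · filter_upwards [(hopen 1).mem_nhds (by simp : (1 : ℝ) < (2 : ℂ).re)] with z hz
      have hz : 1 < z.re := hz
      have h0 : z ≠ 0 := by rintro rfl; simp at hz; linarith
      have h1 := (hM z hz).2
      have h3 := hz1ne z hz
      rw [hsplit z hz] at h1
      simp only [hK]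
      have h2 : deriv riemannZeta₁ z = riemannZeta₁ z * z *
          (deriv riemannZeta₁ z / (z * riemannZeta₁ z)) := by field_simp
      have h4 : deriv riemannZeta₁ z / (z * riemannZeta₁ z) = F₁ - z⁻¹ - psiThetaTransform z -
        (z + 1 - c) * (E z - complexMGF L μ z) := by rw [h1]; ring
      rw [h2, h4]
      field_simp
      ring
  intro hzero
  have hloc := ord_aux riemannZeta₁ K ρ (hζan ρ) (hKan ρ hρ) hzero (by
    filter_upwards [(hopen σ₀).mem_nhds hρ] with z hz using hEq hz)
  have hall : EqOn riemannZeta₁ (fun _ ↦ 0) univ :=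
    AnalyticOnNhd.eqOn_of_preconnected_of_eventuallyEq (𝕜 := ℂ) (z₀ := ρ)
      (fun z _ ↦ hζan z) (fun z _ ↦ analyticAt_const) isPreconnected_univ (mem_univ _) hloc
  have := hall (mem_univ 1)
  simp [riemannZeta₁_one] at this

open Set in
theorem integral_theta_sub_id_div_rpow_pos_frequently
    (homega : 1 / 2 < omegaZ) (homega' : omegaZ ≤ 1)
    (c : ℝ) (hc : c < 1 + omegaZ) :
    ∀ X : ℝ, ∃ x : ℝ, x > X ∧ (∫ t in (2:ℝ)..x, (theta t - t) / t ^ c) > 0 := by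
  intro X
  by_contra hcon
  push Not at hcon
  have hc2 : c < 2 := by linarith
  -- a globally well-behaved integrand
  set h : ℝ → ℝ := fun t ↦ (theta t - t) * (max t 1) ^ (-c) with hh
  have hth : (theta : ℝ → ℝ) = Chebyshev.theta := funext theta_eq_chebyshev
  have hthm : Monotone theta := by rw [hth]; exact Chebyshev.theta_mono
  have hcont : Continuous fun t : ℝ ↦ (max t 1) ^ (-c) := by
    refine Continuous.rpow_const (by fun_prop) fun t ↦ Or.inl ?_
    have := le_max_right t 1
    linarith
  have hm : Measurable h := (hthm.measurable.sub measurable_id).mul hcont.measurable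
  have hii : ∀ a b, IntervalIntegrable h volume a b := by
    intro a b
    refine IntervalIntegrable.mul_continuousOn ?_ hcont.continuousOn
    exact (hthm.intervalIntegrable).sub (continuous_id.intervalIntegrable _ _)
  have hheq : ∀ t, 1 ≤ t → h t = (theta t - t) / t ^ c := by
    intro t ht
    simp only [hh]
    rw [max_eq_left ht, Real.rpow_neg (by linarith), div_eq_mul_inv]
  set F : ℝ → ℝ := fun x ↦ ∫ t in (2 : ℝ)..x, h t with hFdef
  have hFc : Continuous F := intervalIntegral.continuous_primitive hii 2
  have hF : ∀ x, max X 1 < x → F x ≤ 0 := by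
    intro x hx
    have h1 : 1 < x := lt_of_le_of_lt (le_max_right _ _) hx
    have := hcon x (lt_of_le_of_lt (le_max_left _ _) hx)
    refine le_trans (le_of_eq ?_) this
    refine intervalIntegral.integral_congr fun t ht ↦ hheq t ?_
    have : min 2 x ≤ t := ht.1
    have : 1 < min 2 x := lt_min (by norm_num) h1
    linarith
  -- the zero
  have hlt : max (c - 1) (1 / 2) < omegaZ := max_lt (by linarith) homega
  have hne : {r : ℝ | ∃ s : ℂ, riemannZeta s = 0 ∧ s.re = r}.Nonempty :=
    ⟨_, _, riemannZeta_neg_two_mul_nat_add_one 0, rfl⟩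
  obtain ⟨_, ⟨ρ, hρ0, rfl⟩, hρ⟩ := exists_lt_of_lt_csSup hne hlt
  have hρ1 : ρ ≠ 1 := by
    rintro rfl
    exact riemannZeta_ne_zero_of_one_le_re (s := 1) (by simp) hρ0
  refine main_aux F hFc (max X 1) (le_max_right _ _) hF c (F 1) hc2 ?_ ρ hρ ?_
  · intro z hz
    obtain ⟨i1, i2⟩ := theta_transform hz
    set s : ℂ := z + 1 - c with hs
    have hsre : 0 < s.re := by simp [hs]; linarith
    have hs0 : s ≠ 0 := by intro h0; rw [h0] at hsre; simp at hsre
    have hpt : EqOn (fun t : ℝ ↦ ((theta t - t : ℝ) : ℂ) * (t : ℂ) ^ (-(z + 1)))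
        (fun t : ℝ ↦ (h t : ℂ) * (t : ℂ) ^ (-s)) (Ioi 1) := by
      intro t ht
      have ht1 : 1 < t := ht
      have htc : (t : ℂ) ≠ 0 := by exact_mod_cast (by linarith : t ≠ 0)
      simp only [hh]
      rw [max_eq_left ht1.le, Complex.ofReal_mul, Complex.ofReal_cpow (by linarith),
        show -(z + 1) = ((-c : ℝ) : ℂ) + (-s) by simp only [hs]; push_cast; ring,
        Complex.cpow_add _ _ htc]
      ring
    have j1 := i1.congr_fun hpt measurableSet_Ioi
    rw [setIntegral_congr_fun measurableSet_Ioi hpt] at i2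
    obtain ⟨k1, k2⟩ := fubini_aux h hm s hsre j1
    have hre : (-(s + 1)).re < -1 := by simp; linarith
    have l1 : IntegrableOn (fun x : ℝ ↦ (F 1 : ℂ) * (x : ℂ) ^ (-(s + 1))) (Ioi 1) :=
      (integrableOn_Ioi_cpow_of_lt hre one_pos).const_mul _
    have l2 : s * ∫ x in Ioi (1 : ℝ), (F 1 : ℂ) * (x : ℂ) ^ (-(s + 1)) = F 1 := by
      rw [integral_const_mul, integral_Ioi_cpow_of_lt hre one_pos]
      rw [show -(s + 1) + 1 = -s by ring]
      simp only [Complex.ofReal_one, Complex.one_cpow]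
      field_simp
    have he : (fun x : ℝ ↦ (F x : ℂ) * (x : ℂ) ^ (-(z + 2 - c))) = fun x : ℝ ↦
        (F 1 : ℂ) * (x : ℂ) ^ (-(s + 1)) +
        ((∫ t in (1 : ℝ)..x, h t : ℝ) : ℂ) * (x : ℂ) ^ (-(s + 1)) := by
      ext x
      have : F x = F 1 + ∫ t in (1 : ℝ)..x, h t :=
        (intervalIntegral.integral_add_adjacent_intervals (hii 2 1) (hii 1 x)).symm
      rw [this, show z + 2 - c = s + 1 by simp only [hs]; ring]
      push_cast
      ring
    rw [he]
    refine ⟨l1.add k1, ?_⟩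
    rw [integral_add l1 k1, mul_add, l2, k2, i2]
    ring
  · rw [riemannZeta_eq_inv_sub_mul hρ1] at hρ0
    rcases mul_eq_zero.1 hρ0 with h0 | h0
    · exact absurd h0 (inv_ne_zero (sub_ne_zero.2 hρ1))
    · exact h0
end
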